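/- arXiv:0805.0775 — 2 statements merged into one kernel-verified Lean document; each statement's English description precedes it below -/
import Mathlib

section
/- Fix a positive odd integer h, an integer r such that gcd(r,h) is squarefree, and ε > 0. For real T, U, R ≥ 2, define S(T) = Σ_{1 ≤ t ≤ T, t odd, gcd(t²−r,h)=1} Σ_{n ≤ U, n odd} (1/n) Σ_{α mod n, gcd(t²−α,n)=1, α ≡ r mod gcd(n,h)} (α|n) Σ_{d ≤ R, d odd, gcd(d,nt)=1, gcd(d²,h) | r} μ(d)/φ(lcm(n·d²,h)), where (α|n) is the Jacobi symbol, μ is the Möbius function and φ is Euler's totient function. Then there is a constant C = C(h,r,ε) such that for all T, U, R ≥ 2, | S(T) − (3/2)·𝔠(r,h)·T | ≤ C·( T·log R / R + T·U^{ε−1/2} + 1 ). -/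
open scoped Classical

noncomputable section

/-- The local factor at `ℓ` of the constant `𝔠(r,h)`; it is `1` unless `ℓ` is an odd prime. -/
noncomputable def locC (r : ℤ) (h : ℕ) (ℓ : ℕ) : ℝ :=
  if ℓ.Prime ∧ ℓ ≠ 2 then
    if ℓ ∣ h then
      if (ℓ : ℤ) ∣ r then
        (if ¬ (ℓ ^ 2 ∣ h) then ((ℓ : ℝ) - 1) / (ℓ : ℝ) else 1)
      else ((ℓ : ℝ) * ((ℓ : ℝ) - 1 - (jacobiSym r ℓ : ℝ))) /
        (((ℓ : ℝ) - 1) * ((ℓ : ℝ) - (jacobiSym r ℓ : ℝ)))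
    else ((ℓ : ℝ) ^ 4 - 2 * (ℓ : ℝ) ^ 2 - (ℓ : ℝ) + 1) / ((ℓ : ℝ) ^ 2 * ((ℓ : ℝ) ^ 2 - 1))
  else 1

/-- The constant `𝔠(r,h)` of David--Jiménez Urroz. -/
noncomputable def frakC (r : ℤ) (h : ℕ) : ℝ := (1 / (3 * (h : ℝ))) * ∏' ℓ : ℕ, locC r h ℓ

/-- The sum `S(T)` of Theorem 9 of the paper (with cutoffs `U` and `R`). -/
def Ssum (r : ℤ) (h : ℕ) (T U R : ℝ) : ℝ :=
  ∑ t ∈ (Finset.Icc 1 ⌊T⌋₊).filter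
      (fun t : ℕ => Odd t ∧ Int.gcd ((t : ℤ) ^ 2 - r) (h : ℤ) = 1),
    ∑ n ∈ (Finset.Icc 1 ⌊U⌋₊).filter (fun n : ℕ => Odd n),
      (1 / (n : ℝ)) *
        ∑ α ∈ (Finset.range n).filter
            (fun α : ℕ => Int.gcd ((t : ℤ) ^ 2 - (α : ℤ)) (n : ℤ) = 1 ∧
              (α : ℤ) ≡ r [ZMOD (Nat.gcd n h : ℤ)]),
          (jacobiSym (α : ℤ) n : ℝ) *
            ∑ d ∈ (Finset.Icc 1 ⌊R⌋₊).filter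
                (fun d : ℕ => Odd d ∧ Nat.gcd d (n * t) = 1 ∧
                  ((Nat.gcd (d ^ 2) h : ℤ) ∣ r)),
              (ArithmeticFunction.moebius d : ℝ) /
                (Nat.totient (Nat.lcm (n * d ^ 2) h) : ℝ)

/-- The multiplicative function taking the value `φ p k` at `p ^ k` for `p` prime and `k ≥ 1`. -/
def mulExt (φ : ℕ → ℕ → ℝ) (n : ℕ) : ℝ :=
  if n = 0 then 0 else ∏ p ∈ n.primeFactors, φ p (n.factorization p)

@[simp] lemma mulExt_zero (φ : ℕ → ℕ → ℝ) : mulExt φ 0 = 0 := by simp [mulExt]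

@[simp] lemma mulExt_one (φ : ℕ → ℕ → ℝ) : mulExt φ 1 = 1 := by simp [mulExt]

lemma mulExt_of_ne_zero (φ : ℕ → ℕ → ℝ) {n : ℕ} (hn : n ≠ 0) :
    mulExt φ n = ∏ p ∈ n.primeFactors, φ p (n.factorization p) := by simp [mulExt, hn]

lemma mulExt_mul (φ : ℕ → ℕ → ℝ) {m n : ℕ} (hmn : Nat.Coprime m n) :
    mulExt φ (m * n) = mulExt φ m * mulExt φ n := by
  rcases eq_or_ne m 0 with rfl | hm
  · simp
  rcases eq_or_ne n 0 with rfl | hn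
  · simp
  rw [mulExt_of_ne_zero _ hm, mulExt_of_ne_zero _ hn, mulExt_of_ne_zero _ (mul_ne_zero hm hn),
    hmn.primeFactors_mul, Finset.prod_union hmn.disjoint_primeFactors]
  congr 1
  · refine Finset.prod_congr rfl fun p hp => ?_
    rw [Nat.factorization_eq_of_coprime_left hmn (by simpa using hp)]
  · refine Finset.prod_congr rfl fun p hp => ?_
    rw [Nat.factorization_eq_of_coprime_right hmn (by simpa using hp)]

lemma mulExt_prime_pow (φ : ℕ → ℕ → ℝ) {p k : ℕ} (hp : p.Prime) (hk : k ≠ 0) :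
    mulExt φ (p ^ k) = φ p k := by
  rw [mulExt_of_ne_zero _ (pow_ne_zero _ hp.ne_zero), Nat.primeFactors_prime_pow hk hp]
  simp [hp.factorization]

/-- A multiplicative function is determined by its values at prime powers. -/
lemma eq_mulExt (f : ℕ → ℝ) (hmul : ∀ m n, Nat.Coprime m n → f (m * n) = f m * f n)
    (h1 : f 1 = 1) (φ : ℕ → ℕ → ℝ) {n : ℕ} (hn : n ≠ 0)
    (hf : ∀ p ∈ n.primeFactors, ∀ k, k ≠ 0 → f (p ^ k) = φ p k) : f n = mulExt φ n := by
  rw [Nat.multiplicative_factorization f hmul h1 hn, mulExt_of_ne_zero _ hn]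
  refine Finset.prod_congr rfl fun p hp => hf p hp _ ?_
  exact Finsupp.mem_support_iff.mp (by simpa using hp)

lemma abs_mulExt_le {φ ψ : ℕ → ℕ → ℝ} (h : ∀ p k, p.Prime → k ≠ 0 → |φ p k| ≤ ψ p k) (n : ℕ) :
    |mulExt φ n| ≤ mulExt ψ n := by
  rcases eq_or_ne n 0 with rfl | hn
  · simp
  rw [mulExt_of_ne_zero _ hn, mulExt_of_ne_zero _ hn, Finset.abs_prod]
  refine Finset.prod_le_prod (fun _ _ => abs_nonneg _) fun p hp => h p _ ?_ ?_
  · exact Nat.prime_of_mem_primeFactors hp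
  · exact Finsupp.mem_support_iff.mp (by simpa using hp)

lemma mulExt_mul_rpow (φ : ℕ → ℕ → ℝ) (s : ℝ) (n : ℕ) :
    mulExt φ n * (n : ℝ) ^ s = mulExt (fun p k => φ p k * ((p : ℝ) ^ k) ^ s) n := by
  rcases eq_or_ne n 0 with rfl | hn
  · simp
  refine eq_mulExt (fun n => mulExt φ n * (n : ℝ) ^ s) ?_ (by simp) _ hn ?_
  · intro a b hab
    simp only [mulExt_mul _ hab, Nat.cast_mul]
    rw [Real.mul_rpow (by positivity) (by positivity)]
    ring
  · intro p hp k hk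
    simp [mulExt_prime_pow _ (Nat.prime_of_mem_primeFactors hp) hk]

/-- A nonnegative multiplicative function is summable if its sum over prime powers converges. -/
lemma summable_of_multiplicative {f : ℕ → ℝ} (hnn : ∀ n, 0 ≤ f n) (h1 : f 1 = 1)
    (h0 : f 0 = 0) (hmul : ∀ {m n}, Nat.Coprime m n → f (m * n) = f m * f n)
    {B : ℕ → ℝ} (hB0 : ∀ n, 0 ≤ B n) (hB : Summable B)
    (hb : ∀ p : ℕ, p.Prime → Summable (fun k : ℕ => f (p ^ k)) ∧ ∑' k : ℕ, f (p ^ k) ≤ 1 + B p) :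
    Summable f := by
  refine summable_of_sum_range_le (c := Real.exp (∑' n, B n)) hnn fun N => ?_
  have key := EulerProduct.summable_and_hasSum_smoothNumbers_prod_primesBelow_tsum (f := f) h1 hmul
    (fun {p} hp => by simpa only [Real.norm_eq_abs, abs_of_nonneg (hnn _)] using (hb p hp).1) N
  have hsm : Summable (fun m : N.smoothNumbers => f m) := key.2.summable
  calc ∑ i ∈ Finset.range N, f i
      = ∑ i ∈ Finset.range N, (N.smoothNumbers.indicator f) i := by
        refine Finset.sum_congr rfl fun i hi => ?_
        rcases eq_or_ne i 0 with rfl | hi0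
        · simp [h0, Set.indicator_apply]
        · rw [Set.indicator_of_mem]
          exact Nat.mem_smoothNumbers_of_lt (Nat.pos_of_ne_zero hi0) (Finset.mem_range.mp hi)
    _ ≤ ∑' i, (N.smoothNumbers.indicator f) i := by
        refine Summable.sum_le_tsum _ (fun i _ => Set.indicator_nonneg (fun _ _ => hnn _) _) ?_
        exact summable_subtype_iff_indicator.mp hsm
    _ = ∏ p ∈ N.primesBelow, ∑' k : ℕ, f (p ^ k) := by
        rw [← key.2.tsum_eq, tsum_subtype]
    _ ≤ ∏ p ∈ N.primesBelow, Real.exp (B p) := by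
        refine Finset.prod_le_prod (fun p _ => tsum_nonneg fun _ => hnn _) fun p hp => ?_
        refine (hb p (Nat.prime_of_mem_primesBelow hp)).2.trans ?_
        rw [add_comm]
        exact Real.add_one_le_exp _
    _ ≤ Real.exp (∑' n, B n) := by
        rw [← Real.exp_sum]
        exact Real.exp_le_exp.mpr (hB.sum_le_tsum _ fun _ _ => hB0 _)

/-- The multiplicative function with values `c / p ^ 2` at `p` and `c / p ^ k` at `p ^ k` for `k ≥ 2`. -/
def majorant (c : ℝ) : ℕ → ℝ := mulExt fun p k => c / (p : ℝ) ^ (max k 2)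

lemma summable_majorant_mul_rpow {c : ℝ} (hc : 0 ≤ c) {s : ℝ} (hs0 : 0 ≤ s) (hs : s < 1 / 2) :
    Summable fun n : ℕ => majorant c n * (n : ℝ) ^ s := by
  set K : ℝ := c * (1 + (1 - (2 : ℝ) ^ (s - 1))⁻¹) with hK
  have h2 : (2 : ℝ) ^ (s - 1) < 1 := Real.rpow_lt_one_of_one_lt_of_neg (by norm_num) (by linarith)
  have hKinv : 0 < (1 - (2 : ℝ) ^ (s - 1))⁻¹ := inv_pos.mpr (by linarith)
  simp only [majorant, mulExt_mul_rpow]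
  have hnn : ∀ n, 0 ≤ mulExt (fun p k => c / (p : ℝ) ^ (max k 2) * ((p : ℝ) ^ k) ^ s) n :=
    fun n => (abs_nonneg _).trans (abs_mulExt_le (fun p k _ _ => (abs_of_nonneg (by positivity)).le) n)
  refine summable_of_multiplicative hnn (by simp) (by simp) (fun h => mulExt_mul _ h)
    (B := fun n : ℕ => K * (1 / (n : ℝ) ^ (2 - 2 * s))) (fun n => ?_) ?_ ?_
  · positivity
  · exact (Real.summable_one_div_nat_rpow.mpr (by linarith)).mul_left _
  intro p hp
  have hp2 : (2 : ℝ) ≤ p := by exact_mod_cast hp.two_le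
  have hp0 : (0 : ℝ) < p := by linarith
  set q : ℝ := (p : ℝ) ^ (s - 1) with hq
  have hq0 : 0 < q := Real.rpow_pos_of_pos hp0 _
  have hq2 : q ≤ (2 : ℝ) ^ (s - 1) :=
    Real.rpow_le_rpow_of_nonpos (by norm_num) hp2 (by linarith)
  have hq1 : q < 1 := hq2.trans_lt h2
  have hqq : 1 / (p : ℝ) ^ (2 - 2 * s) = q ^ 2 := by
    rw [hq, ← Real.rpow_natCast, ← Real.rpow_mul hp0.le, one_div, ← Real.rpow_neg hp0.le]
    congr 1
    push_cast
    ring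
  set g : ℕ → ℝ := fun k => if k = 0 then c * q ^ 2 else c * (q ^ 2 * q ^ (k - 1)) with hg
  have hsucc : ∀ k : ℕ, mulExt (fun p k => c / (p : ℝ) ^ (max k 2) * ((p : ℝ) ^ k) ^ s) (p ^ (k + 1))
      ≤ g k := by
    intro k
    rw [mulExt_prime_pow _ hp (Nat.succ_ne_zero k)]
    rcases Nat.eq_zero_or_pos k with rfl | hk
    · have h3 : (p : ℝ) ^ s / (p : ℝ) ^ 2 ≤ q ^ 2 := by
        rw [hq, ← Real.rpow_natCast, ← Real.rpow_sub hp0, ← Real.rpow_natCast,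
          ← Real.rpow_mul hp0.le]
        apply Real.rpow_le_rpow_of_exponent_le (by linarith)
        push_cast
        linarith
      calc _ = c * ((p : ℝ) ^ s / (p : ℝ) ^ 2) := by simp; ring
        _ ≤ _ := mul_le_mul_of_nonneg_left h3 hc
    · have hk2 : max (k + 1) 2 = k + 1 := by omega
      have h5 : ((p : ℝ) ^ (k + 1)) ^ s / (p : ℝ) ^ (k + 1) = q ^ (k + 1) := by
        rw [hq, ← Real.rpow_natCast, ← Real.rpow_natCast, ← Real.rpow_mul hp0.le,
          ← Real.rpow_mul hp0.le, ← Real.rpow_sub hp0]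
        congr 1
        ring
      rw [hg]
      simp only [if_neg hk.ne']
      rw [hk2, div_mul_eq_mul_div, mul_div_assoc, h5, ← pow_add, show 2 + (k - 1) = k + 1 by omega]
  have hS : HasSum g (c * (q ^ 2 * (1 - q)⁻¹) + c * q ^ 2) := by
    have := (hasSum_nat_add_iff (f := g) (g := c * (q ^ 2 * (1 - q)⁻¹)) 1).mp
      (by simpa [hg] using ((hasSum_geometric_of_lt_one hq0.le hq1).mul_left (q ^ 2)).mul_left c)
    simpa [hg] using this
  have hsum : Summable fun k : ℕ =>
      mulExt (fun p k => c / (p : ℝ) ^ (max k 2) * ((p : ℝ) ^ k) ^ s) (p ^ (k + 1)) :=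
    Summable.of_nonneg_of_le (fun k => hnn _) hsucc hS.summable
  have hsum' := (summable_nat_add_iff (f := fun k : ℕ =>
      mulExt (fun p k => c / (p : ℝ) ^ (max k 2) * ((p : ℝ) ^ k) ^ s) (p ^ k)) 1).mp hsum
  refine ⟨hsum', ?_⟩
  rw [hsum'.tsum_eq_zero_add]
  simp only [pow_zero, mulExt_one]
  gcongr
  refine (Summable.tsum_le_tsum hsucc hsum hS.summable).trans ?_
  rw [hS.tsum_eq, hqq, hK]
  have h6 : (1 - q)⁻¹ ≤ (1 - (2 : ℝ) ^ (s - 1))⁻¹ := by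
    apply inv_anti₀ <;> linarith
  have h7 : 0 ≤ c * q ^ 2 := by positivity
  nlinarith [mul_le_mul_of_nonneg_left h6 h7]

lemma tail_le_of_summable_mul_rpow {a : ℕ → ℝ} (ha : ∀ n, 0 ≤ a n) {s : ℝ} (hs0 : 0 ≤ s)
    (hs : Summable fun n : ℕ => a n * (n : ℝ) ^ s) {U : ℝ} (hU : 0 < U) :
    ∑' n : ℕ, (if U < n then a n else 0) ≤ U ^ (-s) * ∑' n : ℕ, a n * (n : ℝ) ^ s := by
  rw [← tsum_mul_left]
  have hle : ∀ n : ℕ, (if U < n then a n else 0) ≤ U ^ (-s) * (a n * (n : ℝ) ^ s) := by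
    intro n
    have h0 : 0 ≤ U ^ (-s) * (a n * (n : ℝ) ^ s) := by have := ha n; positivity
    split_ifs with h
    · have h1 : 1 ≤ U ^ (-s) * (n : ℝ) ^ s := by
        rw [Real.rpow_neg hU.le, inv_mul_eq_div, one_le_div (Real.rpow_pos_of_pos hU _)]
        exact Real.rpow_le_rpow hU.le h.le hs0
      nlinarith [ha n]
    · exact h0
  refine Summable.tsum_le_tsum hle ?_ (hs.mul_left _)
  refine Summable.of_nonneg_of_le (fun n => ?_) hle (hs.mul_left _)
  split_ifs
  exacts [ha n, le_rfl]

lemma tail_one_div_sq_le {R : ℝ} (hR : 2 ≤ R) :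
    ∑' d : ℕ, (if R < d then 1 / (d : ℝ) ^ 2 else 0) ≤ 2 / R := by
  have hR0 : 0 < R := by linarith
  refine Real.tsum_le_of_sum_range_le (fun n => by positivity) fun N => ?_
  rw [← Finset.sum_filter]
  calc ∑ d ∈ (Finset.range N).filter (fun d : ℕ => R < d), 1 / (d : ℝ) ^ 2
      ≤ ∑ d ∈ Finset.Ioo ⌊R⌋₊ N, ((d : ℝ) ^ 2)⁻¹ := by
        simp only [one_div]
        refine Finset.sum_le_sum_of_subset_of_nonneg ?_ fun _ _ _ => by positivity
        intro d hd
        simp only [Finset.mem_filter, Finset.mem_range, Finset.mem_Ioo] at hd ⊢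
        exact ⟨(Nat.floor_lt hR0.le).mpr hd.2, hd.1⟩
    _ ≤ 2 / (⌊R⌋₊ + 1) := sum_Ioo_inv_sq_le _ _
    _ ≤ 2 / R := by
        gcongr
        exact (Nat.lt_floor_add_one R).le

lemma majorant_nonneg {c : ℝ} (hc : 0 ≤ c) (n : ℕ) : 0 ≤ majorant c n :=
  (abs_nonneg _).trans (abs_mulExt_le (fun _ _ _ _ => (abs_of_nonneg (by positivity)).le) n)

lemma summable_majorant {c : ℝ} (hc : 0 ≤ c) : Summable (majorant c) := by
  simpa using summable_majorant_mul_rpow hc (le_refl (0 : ℝ)) (by norm_num)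

lemma hasProd_mulExt {a : ℕ → ℕ → ℝ} {c : ℝ} (hc : 0 ≤ c)
    (ha : ∀ p k, p.Prime → k ≠ 0 → |a p k| ≤ c / (p : ℝ) ^ (max k 2)) :
    HasProd (fun p : ℕ => if p.Prime then 1 + ∑' k : ℕ, a p (k + 1) else 1)
      (∑' n, mulExt a n) := by
  have hs : Summable fun n => ‖mulExt a n‖ :=
    Summable.of_nonneg_of_le (fun _ => norm_nonneg _) (fun n => abs_mulExt_le ha n)
      (summable_majorant hc)
  have key := EulerProduct.eulerProduct_hasProd_mulIndicator (f := mulExt a) (mulExt_one a)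
    (fun h => mulExt_mul a h) hs (mulExt_zero a)
  refine (congrArg (fun F : ℕ → ℝ => HasProd F (∑' n, mulExt a n)) ?_).mpr key
  funext p
  by_cases hp : p.Prime
  · rw [if_pos hp, Set.mulIndicator_of_mem (by exact hp)]
    have : Summable fun k : ℕ => mulExt a (p ^ k) :=
      hs.of_norm.comp_injective (Nat.pow_right_injective hp.two_le)
    rw [this.tsum_eq_zero_add]
    simp [mulExt_prime_pow _ hp]
  · rw [if_neg hp, Set.mulIndicator_of_notMem (by exact hp)]

/-- The sum of `mulExt b` over the integers prime to `n`. -/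
def coprimeSum (b : ℕ → ℕ → ℝ) (n : ℕ) : ℝ := ∑' d : ℕ, if Nat.Coprime n d then mulExt b d else 0

lemma coprime_mulExt (b : ℕ → ℕ → ℝ) (n d : ℕ) :
    (if Nat.Coprime n d then mulExt b d else 0)
      = mulExt (fun p k => if p ∣ n then 0 else b p k) d := by
  rcases eq_or_ne d 0 with rfl | hd
  · simp
  rw [mulExt_of_ne_zero _ hd, mulExt_of_ne_zero _ hd]
  split_ifs with h
  · refine Finset.prod_congr rfl fun p hp => ?_
    rw [if_neg fun hpn => ?_]
    exact (Nat.prime_of_mem_primeFactors hp).one_lt.ne'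
      (Nat.eq_one_of_dvd_coprimes h hpn (Nat.dvd_of_mem_primeFactors hp))
  · obtain ⟨p, hp, hpn, hpd⟩ := Nat.Prime.not_coprime_iff_dvd.mp h
    symm
    refine Finset.prod_eq_zero (Nat.mem_primeFactors.mpr ⟨hp, hpd, hd⟩) ?_
    simp [hpn]

lemma tsum_eq_first {b : ℕ → ℝ} (hb : ∀ k, 2 ≤ k → b k = 0) : ∑' k : ℕ, b (k + 1) = b 1 := by
  rw [tsum_eq_single 0 fun k hk => hb _ (by omega)]

lemma hasProd_coprime_pairs {a b : ℕ → ℕ → ℝ} {c : ℝ} (hc : 0 ≤ c)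
    (ha : ∀ p k, p.Prime → k ≠ 0 → |a p k| ≤ c / (p : ℝ) ^ (max k 2))
    (hb : ∀ p k, p.Prime → k ≠ 0 → |b p k| ≤ c / (p : ℝ) ^ (max k 2))
    (hb2 : ∀ p k, 2 ≤ k → b p k = 0) (hb1 : ∀ p, p.Prime → 1 / 2 ≤ 1 + b p 1) :
    HasProd (fun p : ℕ => if p.Prime then 1 + ∑' k : ℕ, a p (k + 1) + b p 1 else 1)
      (∑' n, mulExt a n * coprimeSum b n) := by
  set G := ∑' n, mulExt b n with hG
  have hGp : HasProd (fun p : ℕ => if p.Prime then 1 + b p 1 else 1) G := by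
    simpa only [tsum_eq_first (hb2 _)] using hasProd_mulExt hc hb
  have hne : ∀ p, p.Prime → 1 + b p 1 ≠ 0 := fun p hp => by have := hb1 p hp; linarith
  have hK : ∀ n ≠ 0, coprimeSum b n = G * ∏ p ∈ n.primeFactors, (1 + b p 1)⁻¹ := by
    intro n hn
    have h1 : HasProd (fun p : ℕ => if p.Prime then 1 + (if p ∣ n then 0 else b p 1) else 1)
        (coprimeSum b n) := by
      have := hasProd_mulExt (a := fun p k => if p ∣ n then 0 else b p k) hc (fun p k hp hk => by
        split_ifs
        · simp only [abs_zero]; positivity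
        · exact hb p k hp hk)
      have h2 : ∀ p, ∑' k : ℕ, (if p ∣ n then 0 else b p (k + 1)) = if p ∣ n then 0 else b p 1 :=
        fun p => tsum_eq_first (b := fun k => if p ∣ n then 0 else b p k)
          fun k hk => by simp [hb2 p k hk]
      simp only [h2] at this
      simpa only [coprimeSum, coprime_mulExt b n] using this
    have h3 : HasProd (fun p : ℕ => if p ∈ n.primeFactors then (1 + b p 1)⁻¹ else 1)
        (∏ p ∈ n.primeFactors, (1 + b p 1)⁻¹) := by
      have := hasProd_prod_of_ne_finset_one (L := SummationFilter.unconditional ℕ)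
        (f := fun p : ℕ => if p ∈ n.primeFactors then (1 + b p 1)⁻¹ else 1)
        (s := n.primeFactors) (fun p hp => if_neg hp)
      rwa [Finset.prod_congr rfl fun p hp => if_pos hp] at this
    refine h1.unique ?_
    convert hGp.mul h3 using 1
    funext p
    by_cases hp : p.Prime
    · by_cases hpn : p ∣ n
      · simp [hp, hpn, hn, hne p hp]
      · simp [hp, hpn]
    · simp [hp]
  have hterm : ∀ n, mulExt a n * coprimeSum b n
      = G * mulExt (fun p k => a p k * (1 + b p 1)⁻¹) n := by
    intro n
    rcases eq_or_ne n 0 with rfl | hn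
    · simp
    rw [hK n hn, mulExt_of_ne_zero _ hn, mulExt_of_ne_zero _ hn, Finset.prod_mul_distrib]
    ring
  simp only [hterm, tsum_mul_left]
  have hA := hasProd_mulExt (a := fun p k => a p k * (1 + b p 1)⁻¹) (c := c * 2) (by positivity)
    (fun p k hp hk => by
      have h1 := hb1 p hp
      rw [abs_mul, abs_of_nonneg (a := (1 + b p 1)⁻¹) (by positivity), mul_div_right_comm]
      refine mul_le_mul (ha p k hp hk) ?_ (by positivity) (by positivity)
      rw [inv_le_comm₀ (by linarith) (by norm_num)]
      linarith)
  convert hGp.mul hA using 1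
  funext p
  by_cases hp : p.Prime
  · have := hne p hp
    simp only [hp, if_true, tsum_mul_right]
    field_simp
    ring
  · simp [hp]

lemma abs_tsum_le_tsum {f g : ℕ → ℝ} (h : ∀ n, |f n| ≤ g n) (hg : Summable g) :
    |∑' n, f n| ≤ ∑' n, g n :=
  tsum_of_norm_bounded (f := f) hg.hasSum h

lemma abs_coprime_truncation_le {a b : ℕ → ℕ → ℝ} {c D : ℝ} (hc : 0 ≤ c) (hD : 0 ≤ D)
    (ha : ∀ p k, p.Prime → k ≠ 0 → |a p k| ≤ c / (p : ℝ) ^ (max k 2))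
    (hb : ∀ p k, p.Prime → k ≠ 0 → |b p k| ≤ c / (p : ℝ) ^ (max k 2))
    (hbD : ∀ d, |mulExt b d| ≤ D * (1 / (d : ℝ) ^ 2))
    {s : ℝ} (hs0 : 0 ≤ s) (hs : s < 1 / 2) {U R : ℝ} (hU : 2 ≤ U) (hR : 2 ≤ R) :
    |∑ n ∈ Finset.Icc 1 ⌊U⌋₊, ∑ d ∈ Finset.Icc 1 ⌊R⌋₊,
        (if Nat.Coprime n d then mulExt a n * mulExt b d else 0)
        - ∑' n, mulExt a n * coprimeSum b n|
      ≤ (∑' n, majorant c n) * (D * (2 / R))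
        + (∑' n, majorant c n) * (U ^ (-s) * ∑' n : ℕ, majorant c n * (n : ℝ) ^ s) := by
  set M := ∑' n, majorant c n with hM
  have hM0 : 0 ≤ M := tsum_nonneg (majorant_nonneg hc)
  have hSM := summable_majorant hc
  have hga : ∀ n, |mulExt a n| ≤ majorant c n := abs_mulExt_le ha
  have hgb : ∀ n, |mulExt b n| ≤ majorant c n := abs_mulExt_le hb
  set g : ℕ → ℕ → ℝ := fun n d => if Nat.Coprime n d then mulExt b d else 0 with hg
  have hgle : ∀ n d, |g n d| ≤ |mulExt b d| := fun n d => by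
    simp only [hg]; split_ifs <;> simp
  have hgs : ∀ n, Summable fun d => |g n d| := fun n =>
    Summable.of_nonneg_of_le (fun _ => abs_nonneg _) (fun d => (hgle n d).trans (hgb d)) hSM
  have hK : ∀ n, |coprimeSum b n| ≤ M := fun n =>
    abs_tsum_le_tsum (f := g n) (fun d => (hgle n d).trans (hgb d)) hSM
  set KR : ℕ → ℝ := fun n => ∑ d ∈ Finset.Icc 1 ⌊R⌋₊, g n d with hKR
  have hR0 : 0 ≤ R := by linarith
  have hU0 : 0 ≤ U := by linarith
  have hsq : Summable fun d : ℕ => D * (if R < d then 1 / (d : ℝ) ^ 2 else 0) := by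
    refine Summable.mul_left _ (Summable.of_nonneg_of_le (fun d => by positivity) (fun d => ?_)
      (Real.summable_one_div_nat_pow.mpr one_lt_two))
    split_ifs
    · exact le_rfl
    · positivity
  have hdiff : ∀ n, |coprimeSum b n - KR n| ≤ D * (2 / R) := by
    intro n
    have h1 : KR n = ∑' d, if d ∈ Finset.Icc 1 ⌊R⌋₊ then g n d else 0 := by
      rw [tsum_eq_sum (s := Finset.Icc 1 ⌊R⌋₊) (fun d hd => if_neg hd)]
      exact Finset.sum_congr rfl fun d hd => (if_pos hd).symm
    have hfin : Summable fun d => if d ∈ Finset.Icc 1 ⌊R⌋₊ then g n d else 0 :=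
      summable_of_ne_finset_zero (s := Finset.Icc 1 ⌊R⌋₊) (fun d hd => if_neg hd)
    rw [h1, coprimeSum, ← Summable.tsum_sub (hgs n).of_abs hfin]
    have hle : ∀ d : ℕ, |g n d - (if d ∈ Finset.Icc 1 ⌊R⌋₊ then g n d else 0)|
        ≤ D * (if R < d then 1 / (d : ℝ) ^ 2 else 0) := by
      intro d
      rcases Nat.eq_zero_or_pos d with rfl | hd
      · simp only [hg]; simp
      by_cases h : R < d
      · have hnot : d ∉ Finset.Icc 1 ⌊R⌋₊ := by
          simp only [Finset.mem_Icc, not_and, not_le]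
          exact fun _ => (Nat.floor_lt hR0).mpr h
        rw [if_neg hnot, if_pos h, sub_zero]
        exact (hgle n d).trans (hbD d)
      · have hin : d ∈ Finset.Icc 1 ⌊R⌋₊ :=
          Finset.mem_Icc.mpr ⟨hd, Nat.le_floor (not_lt.mp h)⟩
        rw [if_pos hin, if_neg h]
        simp
    refine (abs_tsum_le_tsum hle hsq).trans ?_
    rw [tsum_mul_left]
    exact mul_le_mul_of_nonneg_left (tail_one_div_sq_le hR) hD
  have hsumA : Summable fun n => mulExt a n * coprimeSum b n := by
    refine Summable.of_norm_bounded (hSM.mul_right M) fun n => ?_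
    rw [norm_mul]
    exact mul_le_mul (hga n) (hK n) (abs_nonneg _) (majorant_nonneg hc n)
  have hlhs : ∑ n ∈ Finset.Icc 1 ⌊U⌋₊, ∑ d ∈ Finset.Icc 1 ⌊R⌋₊,
        (if Nat.Coprime n d then mulExt a n * mulExt b d else 0)
      = ∑' n, if n ∈ Finset.Icc 1 ⌊U⌋₊ then mulExt a n * KR n else 0 := by
    rw [tsum_eq_sum (s := Finset.Icc 1 ⌊U⌋₊) (fun d hd => if_neg hd)]
    refine Finset.sum_congr rfl fun n hn => ?_
    rw [if_pos hn, hKR, Finset.mul_sum]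
    refine Finset.sum_congr rfl fun d _ => ?_
    simp only [hg]; split_ifs <;> simp
  have hfin : Summable fun n => if n ∈ Finset.Icc 1 ⌊U⌋₊ then mulExt a n * KR n else 0 :=
    summable_of_ne_finset_zero (s := Finset.Icc 1 ⌊U⌋₊) (fun d hd => if_neg hd)
  have hcut : Summable fun n : ℕ => if U < n then majorant c n else 0 := by
    refine Summable.of_nonneg_of_le (fun n => ?_) (fun n => ?_) hSM
    · split_ifs; exacts [majorant_nonneg hc n, le_rfl]
    · split_ifs; exacts [le_rfl, majorant_nonneg hc n]
  have hbound := (hSM.mul_right (D * (2 / R))).add (hcut.mul_left M)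
  rw [hlhs, ← Summable.tsum_sub hfin hsumA]
  have hle : ∀ n : ℕ, |(if n ∈ Finset.Icc 1 ⌊U⌋₊ then mulExt a n * KR n else 0)
      - mulExt a n * coprimeSum b n|
      ≤ majorant c n * (D * (2 / R)) + M * (if U < n then majorant c n else 0) := by
    intro n
    have hm := majorant_nonneg hc n
    rcases Nat.eq_zero_or_pos n with rfl | hn
    · have : 0 ≤ M * (if U < ((0 : ℕ) : ℝ) then majorant c 0 else 0) := by
        split_ifs <;> positivity
      have h2 : 0 ≤ majorant c 0 * (D * (2 / R)) := by positivity
      simp only [mulExt_zero, zero_mul, ite_self, sub_zero, abs_zero]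
      exact add_nonneg h2 this
    by_cases h : U < n
    · have hnot : n ∉ Finset.Icc 1 ⌊U⌋₊ := by
        simp only [Finset.mem_Icc, not_and, not_le]
        exact fun _ => (Nat.floor_lt hU0).mpr h
      rw [if_neg hnot, if_pos h, zero_sub, abs_neg, abs_mul]
      have h1 : |mulExt a n| * |coprimeSum b n| ≤ majorant c n * M :=
        mul_le_mul (hga n) (hK n) (abs_nonneg _) hm
      have h2 : 0 ≤ majorant c n * (D * (2 / R)) := by positivity
      linarith
    · have hin : n ∈ Finset.Icc 1 ⌊U⌋₊ :=
        Finset.mem_Icc.mpr ⟨hn, Nat.le_floor (not_lt.mp h)⟩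
      rw [if_pos hin, if_neg h, mul_zero, add_zero, ← mul_sub, abs_mul, abs_sub_comm]
      exact mul_le_mul (hga n) (hdiff n) (abs_nonneg _) hm
  refine (abs_tsum_le_tsum hle hbound).trans ?_
  rw [(hSM.mul_right (D * (2 / R))).tsum_add (hcut.mul_left M), tsum_mul_right, tsum_mul_left]
  gcongr
  exact tail_le_of_summable_mul_rpow (majorant_nonneg hc) hs0 (summable_majorant_mul_rpow hc hs0 hs)
    (by linarith)

lemma sum_range_mul_of_periodic {m : ℕ} {u : ℕ → ℝ} (hu : ∀ a, u a = u (a % m)) (b : ℕ) :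
    ∑ a ∈ Finset.range (m * b), u a = b * ∑ a ∈ Finset.range m, u a := by
  induction b with
  | zero => simp
  | succ b ih =>
    rw [mul_add, mul_one, Finset.sum_range_add, ih]
    have : ∀ x ∈ Finset.range m, u (m * b + x) = u x := fun x _ => by
      rw [hu, Nat.mul_add_mod, ← hu]
    rw [Finset.sum_congr rfl this]
    push_cast
    ring

lemma sum_range_mul_of_coprime {m n : ℕ} (hm : 0 < m) (hn : 0 < n) (hmn : Nat.Coprime m n)
    {u v : ℕ → ℝ} (hu : ∀ a, u a = u (a % m)) (hv : ∀ a, v a = v (a % n)) :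
    ∑ a ∈ Finset.range (m * n), u a * v a
      = (∑ a ∈ Finset.range m, u a) * ∑ a ∈ Finset.range n, v a := by
  rw [Finset.sum_mul_sum, ← Finset.sum_product']
  have hinj : Set.InjOn (fun a : ℕ => (a % m, a % n)) (Finset.range (m * n) : Set ℕ) := by
    intro a ha b hb hab
    simp only [Prod.mk.injEq] at hab
    have h1 : a ≡ b [MOD m * n] :=
      (Nat.modEq_and_modEq_iff_modEq_mul hmn).mp ⟨hab.1, hab.2⟩
    exact Nat.ModEq.eq_of_lt_of_lt h1 (by simpa using ha) (by simpa using hb)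
  have hmaps : Set.MapsTo (fun a : ℕ => (a % m, a % n)) (Finset.range (m * n) : Set ℕ)
      ((Finset.range m ×ˢ Finset.range n : Finset (ℕ × ℕ)) : Set (ℕ × ℕ)) := by
    intro a _
    simp [Nat.mod_lt _ hm, Nat.mod_lt _ hn]
  refine Finset.sum_nbij (fun a => (a % m, a % n)) hmaps hinj ?_ fun a _ => ?_
  · exact Finset.surjOn_of_injOn_of_card_le _ hmaps hinj (by simp)
  · simp only [← hu, ← hv]

lemma sum_range_dilate {m e : ℕ} (hm : 0 < m) (he : Nat.Coprime e m) {u : ℕ → ℝ}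
    (hu : ∀ a, u a = u (a % m)) :
    ∑ a ∈ Finset.range m, u (e * a) = ∑ a ∈ Finset.range m, u a := by
  have hinj : Set.InjOn (fun a : ℕ => e * a % m) (Finset.range m : Set ℕ) := by
    intro a ha b hb hab
    have h1 : e * a ≡ e * b [MOD m] := hab
    exact Nat.ModEq.eq_of_lt_of_lt (Nat.ModEq.cancel_left_of_coprime he.symm h1)
      (by simpa using ha) (by simpa using hb)
  have hmaps : Set.MapsTo (fun a : ℕ => e * a % m) (Finset.range m : Set ℕ)
      (Finset.range m : Set ℕ) := by
    intro a _
    simp [Nat.mod_lt _ hm]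
  refine Finset.sum_nbij (fun a => e * a % m) hmaps hinj ?_ fun a _ => ?_
  · exact Finset.surjOn_of_injOn_of_card_le _ hmaps hinj le_rfl
  · rw [← hu]

lemma abs_sum_Icc_periodic_sub_le {M : ℕ} (hM : 0 < M) {u : ℕ → ℝ} (hu : ∀ a, u a = u (a % M))
    (hu0 : ∀ a, 0 ≤ u a) (hu1 : ∀ a, u a ≤ 1) (N : ℕ) :
    |∑ a ∈ Finset.Icc 1 N, u a - N * ((∑ a ∈ Finset.range M, u a) / M)| ≤ M := by
  set w : ℕ → ℝ := fun a => u (a + 1) with hw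
  have hwp : ∀ a, w a = w (a % M) := fun a => by
    simp only [hw]
    rw [hu, Nat.add_mod, ← hu, hu (a % M + 1), Nat.add_mod (a % M), Nat.mod_mod, ← hu]
  have hS : ∑ a ∈ Finset.range M, w a = ∑ a ∈ Finset.range M, u a := by
    have h1 := Finset.sum_range_succ u M
    have h2 := Finset.sum_range_succ' u M
    have h3 : u M = u 0 := by rw [hu M, Nat.mod_self]
    simp only [hw]
    linarith
  have hIcc : ∑ a ∈ Finset.Icc 1 N, u a = ∑ a ∈ Finset.range N, w a := by
    rw [Finset.range_eq_Ico, Finset.sum_Ico_add' u 0 N 1]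
    rfl
  rw [hIcc, ← hS]
  set S := ∑ a ∈ Finset.range M, w a with hSdef
  have hS0 : 0 ≤ S := Finset.sum_nonneg fun a _ => hu0 _
  have hSM : S ≤ M := by
    have := Finset.sum_le_card_nsmul (Finset.range M) w 1 fun a _ => hu1 _
    simpa using this
  have hN : ∑ a ∈ Finset.range N, w a
      = (N / M : ℕ) * S + ∑ a ∈ Finset.range (N % M), w (M * (N / M) + a) := by
    conv_lhs => rw [← Nat.div_add_mod N M]
    rw [Finset.sum_range_add, sum_range_mul_of_periodic hwp]
  have hNr : (N : ℝ) = M * (N / M : ℕ) + (N % M : ℕ) := by exact_mod_cast (Nat.div_add_mod N M).symm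
  have hrest0 : 0 ≤ ∑ a ∈ Finset.range (N % M), w (M * (N / M) + a) :=
    Finset.sum_nonneg fun a _ => hu0 _
  have hrest : ∑ a ∈ Finset.range (N % M), w (M * (N / M) + a) ≤ (N % M : ℕ) := by
    have := Finset.sum_le_card_nsmul (Finset.range (N % M)) (fun a => w (M * (N / M) + a)) 1
      fun a _ => hu1 _
    simpa using this
  have hM' : (0 : ℝ) < M := by exact_mod_cast hM
  have hr : ((N % M : ℕ) : ℝ) ≤ M := by exact_mod_cast (Nat.mod_lt _ hM).le
  have hfrac1 : S / M ≤ 1 := by rw [div_le_one hM']; exact hSM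
  have hfrac0 : 0 ≤ S / M := by positivity
  have hq : (M : ℝ) * (N / M : ℕ) * (S / M) = (N / M : ℕ) * S := by field_simp
  have hr0 : (0 : ℝ) ≤ (N % M : ℕ) := by positivity
  rw [hN, hNr, add_mul, hq, abs_le]
  constructor <;> nlinarith

/-- The number of residues `v` modulo `h` such that `v ^ 2 - r` is a unit modulo `h`. -/
def unitCount (r : ℤ) (h : ℕ) : ℝ :=
  ∑ v ∈ Finset.range h, if Int.gcd ((v : ℤ) ^ 2 - r) (h : ℤ) = 1 then 1 else 0

lemma gcd_eq_of_modEq {a b m : ℤ} (hab : a ≡ b [ZMOD m]) : Int.gcd a m = Int.gcd b m := by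
  obtain ⟨k, hk⟩ := hab.symm.dvd
  rw [show a = b + m * k by linarith]
  simp

lemma gcd_sq_sub_mod (r : ℤ) (h a : ℕ) :
    Int.gcd ((a : ℤ) ^ 2 - r) (h : ℤ) = Int.gcd (((a % h : ℕ) : ℤ) ^ 2 - r) (h : ℤ) := by
  have h1 : ((a : ℤ) ^ 2 - r) ≡ (((a % h : ℕ) : ℤ) ^ 2 - r) [ZMOD h] := by
    refine Int.ModEq.sub_right _ (Int.ModEq.pow 2 ?_)
    push_cast
    exact (Int.mod_modEq _ _).symm
  exact gcd_eq_of_modEq h1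

lemma abs_card_multiples_sub_le {r : ℤ} {h : ℕ} (hpos : 0 < h) (hodd : Odd h) {e : ℕ}
    (he : Nat.Coprime e (2 * h)) {T : ℝ} (hT : 0 ≤ T) :
    |∑ t ∈ (Finset.Icc 1 ⌊T⌋₊).filter
        (fun t : ℕ => Odd t ∧ Int.gcd ((t : ℤ) ^ 2 - r) (h : ℤ) = 1), (if e ∣ t then (1 : ℝ) else 0)
      - T / e * (unitCount r h / (2 * h))| ≤ 2 * h + 1 := by
  have he0 : 0 < e := by
    rcases Nat.eq_zero_or_pos e with rfl | h'
    · rw [Nat.coprime_zero_left] at he; omega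
    · exact h'
  have heo : Odd e := by
    rw [← Nat.coprime_two_right]
    exact he.coprime_mul_right_right
  have heh : Nat.Coprime e h := he.coprime_mul_left_right
  set u1 : ℕ → ℝ := fun s => if Odd s then 1 else 0 with hu1
  set w : ℕ → ℝ := fun s => if Int.gcd ((s : ℤ) ^ 2 - r) (h : ℤ) = 1 then 1 else 0 with hw
  have hu1p : ∀ a, u1 a = u1 (a % 2) := fun a => by simp [hu1, Nat.odd_iff]
  have hwp : ∀ a, w a = w (a % h) := fun a => by
    simp only [hw]; rw [gcd_sq_sub_mod]
  have hwep : ∀ a, w (e * a) = w (e * (a % h)) := fun a => by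
    rw [hwp, Nat.mul_mod, ← Nat.mod_mod a, ← Nat.mul_mod, ← hwp, Nat.mod_mod]
  set u : ℕ → ℝ := fun s => u1 s * w (e * s) with hu
  have hup : ∀ a, u a = u (a % (2 * h)) := fun a => by
    simp only [hu]
    rw [hu1p (a % (2 * h)), hwep (a % (2 * h)), Nat.mod_mul_right_mod, Nat.mod_mul_left_mod,
      ← hu1p, ← hwep]
  have hsum : ∑ a ∈ Finset.range (2 * h), u a = unitCount r h := by
    rw [sum_range_mul_of_coprime (by norm_num) hpos
      ((Nat.coprime_two_left).mpr hodd) hu1p hwep, sum_range_dilate hpos heh hwp]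
    rw [Finset.sum_range_succ, Finset.sum_range_one]
    simp [hu1, unitCount, hw]
  have hN : ∑ t ∈ (Finset.Icc 1 ⌊T⌋₊).filter
        (fun t : ℕ => Odd t ∧ Int.gcd ((t : ℤ) ^ 2 - r) (h : ℤ) = 1), (if e ∣ t then (1 : ℝ) else 0)
      = ∑ s ∈ Finset.Icc 1 ⌊T / e⌋₊, u s := by
    rw [Finset.sum_filter]
    have h1 : ∀ t ∈ Finset.Icc 1 ⌊T⌋₊, (if Odd t ∧ Int.gcd ((t : ℤ) ^ 2 - r) (h : ℤ) = 1 then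
        (if e ∣ t then (1 : ℝ) else 0) else 0) = if e ∣ t then u (t / e) else 0 := by
      intro t _
      by_cases hd : e ∣ t
      · obtain ⟨s, rfl⟩ := hd
        simp only [hu, hu1, hw, Nat.mul_div_cancel_left _ he0, dvd_mul_right, if_true]
        have : Odd (e * s) ↔ Odd s := by rw [Nat.odd_mul]; exact and_iff_right heo
        by_cases h2 : Odd s
        · simp [this, h2]
        · simp [this, h2]
      · simp [hd]
    rw [Finset.sum_congr rfl h1, ← Finset.sum_filter]
    symm
    refine Finset.sum_nbij' (fun s => e * s) (fun t => t / e) ?_ ?_ ?_ ?_ ?_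
    · intro s hs
      simp only [Finset.mem_Icc, Finset.mem_filter, dvd_mul_right, and_true] at hs ⊢
      refine ⟨Nat.mul_pos he0 hs.1, ?_⟩
      rw [Nat.le_floor_iff (by positivity), le_div_iff₀ (by exact_mod_cast he0)] at hs
      rw [Nat.le_floor_iff hT]
      push_cast
      linarith [hs.2]
    · intro t ht
      simp only [Finset.mem_Icc, Finset.mem_filter] at ht ⊢
      obtain ⟨⟨ht1, ht2⟩, s, rfl⟩ := ht
      rw [Nat.mul_div_cancel_left _ he0]
      refine ⟨Nat.pos_of_mul_pos_left ht1, ?_⟩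
      rw [Nat.le_floor_iff hT] at ht2
      rw [Nat.le_floor_iff (by positivity), le_div_iff₀ (by exact_mod_cast he0)]
      push_cast at ht2
      linarith
    · intro s _
      exact Nat.mul_div_cancel_left _ he0
    · intro t ht
      exact Nat.mul_div_cancel' (Finset.mem_filter.mp ht).2
    · intro s _
      simp [Nat.mul_div_cancel_left _ he0]
  have hmain := abs_sum_Icc_periodic_sub_le (M := 2 * h) (by omega) hup
    (fun a => by simp only [hu, hu1, hw]; split_ifs <;> simp)
    (fun a => by simp only [hu, hu1, hw]; split_ifs <;> simp) ⌊T / e⌋₊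
  rw [hsum] at hmain
  rw [hN]
  push_cast at hmain
  set ρ := unitCount r h / (2 * h) with hρ
  have hh : (0 : ℝ) < h := by exact_mod_cast hpos
  have hc0 : 0 ≤ unitCount r h := Finset.sum_nonneg fun _ _ => by split_ifs <;> simp
  have hc1 : unitCount r h ≤ h := by
    have := Finset.sum_le_card_nsmul (Finset.range h) w 1 fun a _ => by
      simp only [hw]; split_ifs <;> simp
    simpa [unitCount, hw] using this
  have hρ0 : 0 ≤ ρ := by positivity
  have hρ1 : ρ ≤ 1 := by rw [hρ, div_le_one (by positivity)]; linarith
  have hf1 := Nat.floor_le (a := T / e) (by positivity)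
  have hf2 := Nat.lt_floor_add_one (T / e)
  rw [abs_le] at hmain ⊢
  constructor <;> nlinarith

lemma abs_sum_prod_sub_le {r : ℤ} {h : ℕ} (hpos : 0 < h) (hodd : Odd h) {P : Finset ℕ}
    (hP : ∀ p ∈ P, p.Prime) {X Y : ℕ → ℝ} (hY : ∀ p ∈ P, p ∣ 2 * h → Y p = 0)
    {T : ℝ} (hT : 0 ≤ T) :
    |∑ t ∈ (Finset.Icc 1 ⌊T⌋₊).filter
        (fun t : ℕ => Odd t ∧ Int.gcd ((t : ℤ) ^ 2 - r) (h : ℤ) = 1),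
        ∏ p ∈ P, (X p + if p ∣ t then Y p else 0)
      - T * (unitCount r h / (2 * h)) * ∏ p ∈ P, (X p + Y p / p)|
      ≤ (2 * h + 1) * ∏ p ∈ P, (|X p| + |Y p|) := by
  have hexp : ∀ t : ℕ, ∏ p ∈ P, (X p + if p ∣ t then Y p else 0)
      = ∑ E ∈ P.powerset, ((∏ p ∈ E, Y p) * ∏ p ∈ P \ E, X p)
        * (if (∏ p ∈ E, p) ∣ t then 1 else 0) := by
    intro t
    simp only [add_comm (X _)]
    rw [Finset.prod_add]
    refine Finset.sum_congr rfl fun E hE => ?_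
    have hEP : ∀ p ∈ E, p.Prime := fun p hp => hP p (Finset.mem_powerset.mp hE hp)
    split_ifs with hd
    · rw [mul_one]
      congr 1
      exact Finset.prod_congr rfl fun p hp => if_pos ((Finset.dvd_prod_of_mem _ hp).trans hd)
    · rw [mul_zero]
      have : ∃ p ∈ E, ¬ p ∣ t := by
        by_contra hcon
        push Not at hcon
        exact hd (Finset.prod_primes_dvd t (fun p hp => (hEP p hp).prime) hcon)
      obtain ⟨p, hp, hpt⟩ := this
      rw [Finset.prod_eq_zero hp (if_neg hpt), zero_mul]
  have hmain : ∏ p ∈ P, (X p + Y p / p)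
      = ∑ E ∈ P.powerset, ((∏ p ∈ E, Y p) * ∏ p ∈ P \ E, X p) * (1 / ((∏ p ∈ E, p : ℕ) : ℝ)) := by
    simp only [add_comm (X _)]
    rw [Finset.prod_add]
    refine Finset.sum_congr rfl fun E _ => ?_
    rw [Finset.prod_div_distrib]
    push_cast
    ring
  have habs : ∏ p ∈ P, (|X p| + |Y p|)
      = ∑ E ∈ P.powerset, |(∏ p ∈ E, Y p) * ∏ p ∈ P \ E, X p| := by
    simp only [add_comm |X _|]
    rw [Finset.prod_add]
    simp only [abs_mul, Finset.abs_prod]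
  simp only [hexp]
  rw [hmain, habs, Finset.sum_comm, Finset.mul_sum, Finset.mul_sum, ← Finset.sum_sub_distrib]
  refine (Finset.abs_sum_le_sum_abs _ _).trans (Finset.sum_le_sum fun E hE => ?_)
  rw [← Finset.mul_sum]
  set A := (∏ p ∈ E, Y p) * ∏ p ∈ P \ E, X p with hA
  by_cases hcop : Nat.Coprime (∏ p ∈ E, p) (2 * h)
  · have := abs_card_multiples_sub_le (r := r) hpos hodd hcop hT
    rw [show ∀ S ρ q : ℝ, A * S - T * ρ * (A * (1 / q)) = A * (S - T / q * ρ) from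
      fun S ρ q => by ring, abs_mul, mul_comm]
    exact mul_le_mul_of_nonneg_right this (abs_nonneg _)
  · have : ∃ p ∈ E, p ∣ 2 * h := by
      by_contra hcon
      push Not at hcon
      refine hcop (Nat.Coprime.prod_left fun p hp => ?_)
      exact (Nat.Prime.coprime_iff_not_dvd (hP p (Finset.mem_powerset.mp hE hp))).mpr (hcon p hp)
    obtain ⟨p, hp, hpd⟩ := this
    have hA0 : A = 0 := by
      rw [hA, Finset.prod_eq_zero hp (hY p (Finset.mem_powerset.mp hE hp) hpd), zero_mul]
    simp [hA0]

/-- The sum over `α` in the definition of `Ssum`. -/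
def charSum (r : ℤ) (h t n : ℕ) : ℝ :=
  ∑ α ∈ (Finset.range n).filter
      (fun α : ℕ => Int.gcd ((t : ℤ) ^ 2 - (α : ℤ)) (n : ℤ) = 1 ∧
        (α : ℤ) ≡ r [ZMOD (Nat.gcd n h : ℤ)]), (jacobiSym (α : ℤ) n : ℝ)

/-- The summand of `charSum`. -/
def charWeight (r : ℤ) (h t n α : ℕ) : ℝ :=
  if Int.gcd ((t : ℤ) ^ 2 - (α : ℤ)) (n : ℤ) = 1 ∧ (α : ℤ) ≡ r [ZMOD (Nat.gcd n h : ℤ)] then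
    (jacobiSym (α : ℤ) n : ℝ) else 0

lemma charSum_eq (r : ℤ) (h t n : ℕ) :
    charSum r h t n = ∑ α ∈ Finset.range n, charWeight r h t n α := by
  rw [charSum, Finset.sum_filter]
  rfl

lemma charWeight_mod (r : ℤ) (h t n α : ℕ) :
    charWeight r h t n α = charWeight r h t n (α % n) := by
  have h1 : (α : ℤ) ≡ ((α % n : ℕ) : ℤ) [ZMOD n] := by
    push_cast
    exact (Int.mod_modEq _ _).symm
  have h2 : Int.gcd ((t : ℤ) ^ 2 - (α : ℤ)) (n : ℤ)
      = Int.gcd ((t : ℤ) ^ 2 - ((α % n : ℕ) : ℤ)) (n : ℤ) :=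
    gcd_eq_of_modEq (h1.sub_left _)
  have h3 : (α : ℤ) ≡ ((α % n : ℕ) : ℤ) [ZMOD (Nat.gcd n h : ℤ)] :=
    h1.of_dvd (by exact_mod_cast Nat.gcd_dvd_left n h)
  have h4 : ((α : ℤ) ≡ r [ZMOD (Nat.gcd n h : ℤ)])
      ↔ (((α % n : ℕ) : ℤ) ≡ r [ZMOD (Nat.gcd n h : ℤ)]) :=
    ⟨fun h => h3.symm.trans h, fun h => h3.trans h⟩
  have h5 : jacobiSym (α : ℤ) n = jacobiSym ((α % n : ℕ) : ℤ) n := jacobiSym.mod_left' h1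
  simp only [charWeight, h2, h4, h5]

lemma charWeight_mul (r : ℤ) (h t α : ℕ) {m n : ℕ} (hm : m ≠ 0) (hn : n ≠ 0)
    (hmn : Nat.Coprime m n) :
    charWeight r h t (m * n) α = charWeight r h t m α * charWeight r h t n α := by
  have h1 : Int.gcd ((t : ℤ) ^ 2 - (α : ℤ)) ((m * n : ℕ) : ℤ) = 1
      ↔ Int.gcd ((t : ℤ) ^ 2 - (α : ℤ)) (m : ℤ) = 1 ∧
        Int.gcd ((t : ℤ) ^ 2 - (α : ℤ)) (n : ℤ) = 1 := by
    simp only [← Int.isCoprime_iff_gcd_eq_one]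
    push_cast
    exact IsCoprime.mul_right_iff
  have hc : Nat.Coprime (Nat.gcd m h) (Nat.gcd n h) :=
    Nat.Coprime.coprime_dvd_left (Nat.gcd_dvd_left _ _)
      (Nat.Coprime.coprime_dvd_right (Nat.gcd_dvd_left _ _) hmn)
  have h2 : ((α : ℤ) ≡ r [ZMOD (Nat.gcd (m * n) h : ℤ)])
      ↔ ((α : ℤ) ≡ r [ZMOD (Nat.gcd m h : ℤ)]) ∧ ((α : ℤ) ≡ r [ZMOD (Nat.gcd n h : ℤ)]) := by
    rw [Nat.gcd_comm (m * n), Nat.Coprime.gcd_mul h hmn, Nat.gcd_comm h, Nat.gcd_comm h]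
    push_cast
    exact (Int.modEq_and_modEq_iff_modEq_mul (by simpa using hc)).symm
  have h3 := jacobiSym.mul_right' (α : ℤ) hm hn
  simp only [charWeight, h1, h2, h3]
  push_cast
  split_ifs <;> first | rfl | (exfalso; tauto) | simp

lemma charSum_mul (r : ℤ) (h t : ℕ) (m n : ℕ) (hmn : Nat.Coprime m n) :
    charSum r h t (m * n) = charSum r h t m * charSum r h t n := by
  rcases Nat.eq_zero_or_pos m with rfl | hm
  · simp [charSum]
  rcases Nat.eq_zero_or_pos n with rfl | hn
  · simp [charSum]
  simp only [charSum_eq]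
  rw [← sum_range_mul_of_coprime hm hn hmn (charWeight_mod r h t m) (charWeight_mod r h t n)]
  exact Finset.sum_congr rfl fun α _ => charWeight_mul r h t α hm.ne' hn.ne' hmn

lemma charSum_one (r : ℤ) (h t : ℕ) : charSum r h t 1 = 1 := by
  simp [charSum_eq, charWeight, Int.modEq_one]

lemma sum_range_eq_sum_zmod (p : ℕ) [NeZero p] (f : ZMod p → ℝ) :
    ∑ a ∈ Finset.range p, f (a : ZMod p) = ∑ a : ZMod p, f a := by
  refine Finset.sum_nbij' (fun a => (a : ZMod p)) (fun a => a.val) (by simp) ?_ ?_ ?_ (by simp)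
  · intro a _; simpa using ZMod.val_lt a
  · intro a ha; exact ZMod.val_cast_of_lt (by simpa using ha)
  · intro a _; simp

lemma jacobiSym_eq_quadraticChar (p : ℕ) [Fact p.Prime] (a : ℤ) :
    jacobiSym a p = quadraticChar (ZMod p) (a : ZMod p) := by
  rw [← jacobiSym.legendreSym.to_jacobiSym]
  rfl

lemma jacobiSym_sq_prime {p : ℕ} (hp : p.Prime) (a : ℤ) :
    jacobiSym a p ^ 2 = if (p : ℤ) ∣ a then 0 else 1 := by
  have := Fact.mk hp
  rw [jacobiSym_eq_quadraticChar]
  split_ifs with h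
  · rw [(ZMod.intCast_zmod_eq_zero_iff_dvd a p).mpr h]
    simp
  · exact quadraticChar_sq_one fun h0 => h ((ZMod.intCast_zmod_eq_zero_iff_dvd a p).mp h0)

lemma sum_jacobiSym_pow {p : ℕ} (hp : p.Prime) (hp2 : p ≠ 2) {k : ℕ} (hk : k ≠ 0) :
    ∑ a ∈ Finset.range p, (jacobiSym (a : ℤ) p : ℝ) ^ k = if Even k then (p : ℝ) - 1 else 0 := by
  have := Fact.mk hp
  split_ifs with hev
  · obtain ⟨j, rfl⟩ := hev
    have h1 : ∀ a ∈ Finset.range p,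
        (jacobiSym (a : ℤ) p : ℝ) ^ (j + j) = 1 - if a = 0 then 1 else 0 := by
      intro a ha
      have hj : j ≠ 0 := by omega
      have hdv : (p : ℤ) ∣ (a : ℤ) ↔ a = 0 := by
        rw [Int.natCast_dvd_natCast]
        exact ⟨fun h => Nat.eq_zero_of_dvd_of_lt h (by simpa using ha), fun h => by simp [h]⟩
      rw [← two_mul, pow_mul, ← Int.cast_pow, jacobiSym_sq_prime hp]
      simp only [hdv]
      split_ifs <;> simp [hj]
    rw [Finset.sum_congr rfl h1, Finset.sum_sub_distrib]
    simp [hp.pos]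
  · obtain ⟨j, rfl⟩ := Nat.not_even_iff_odd.mp hev
    have h1 : ∀ a ∈ Finset.range p, (jacobiSym (a : ℤ) p : ℝ) ^ (2 * j + 1)
        = ((quadraticChar (ZMod p) (a : ZMod p) : ℤ) : ℝ) := by
      intro a _
      rcases jacobiSym.trichotomy (a : ℤ) p with h | h | h <;>
      · have h' := h
        rw [jacobiSym_eq_quadraticChar, Int.cast_natCast] at h'
        rw [h, h']
        simp [pow_add, pow_mul]
    rw [Finset.sum_congr rfl h1,
      sum_range_eq_sum_zmod p (fun a => ((quadraticChar (ZMod p) a : ℤ) : ℝ)), ← Int.cast_sum,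
      quadraticChar_sum_zero (by rwa [ZMod.ringChar_zmod_n])]
    simp

lemma gcd_prime_pow_eq_one_iff {p k : ℕ} (hp : p.Prime) (hk : k ≠ 0) (a : ℤ) :
    Int.gcd a ((p ^ k : ℕ) : ℤ) = 1 ↔ ¬ (p : ℤ) ∣ a := by
  rw [← Int.isCoprime_iff_gcd_eq_one]
  push_cast
  rw [IsCoprime.pow_right_iff (Nat.pos_of_ne_zero hk), isCoprime_comm,
    (Nat.prime_iff_prime_int.mp hp).coprime_iff_not_dvd]

lemma charSum_prime_pow_of_not_dvd (r : ℤ) {h p k : ℕ} (t : ℕ) (hp : p.Prime) (hp2 : p ≠ 2)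
    (hph : ¬ p ∣ h) (hk : k ≠ 0) :
    charSum r h t (p ^ k) = (p : ℝ) ^ (k - 1) *
      ((if Even k then (p : ℝ) - 1 else 0) - if p ∣ t then 0 else 1) := by
  set u : ℕ → ℝ := fun α => (jacobiSym (α : ℤ) p : ℝ) ^ k with hu
  have hup : ∀ a, u a = u (a % p) := fun a => by
    simp only [hu]
    rw [jacobiSym.mod_left' (a₁ := (a : ℤ)) (a₂ := ((a % p : ℕ) : ℤ)) (by simp)]
  have hg : Nat.gcd (p ^ k) h = 1 := by
    exact Nat.Coprime.pow_left k ((Nat.Prime.coprime_iff_not_dvd hp).mpr hph)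
  have hiff : ∀ α : ℕ, (p : ℤ) ∣ (t : ℤ) ^ 2 - α ↔ α % p = t ^ 2 % p := fun α => by
    rw [← Nat.ModEq, ← Int.natCast_modEq_iff, Int.modEq_iff_dvd]
    push_cast
    rfl
  have hw : ∀ α, charWeight r h t (p ^ k) α = u α - if α % p = t ^ 2 % p then u α else 0 := by
    intro α
    simp only [charWeight, hg, gcd_prime_pow_eq_one_iff hp hk, hiff, Nat.cast_one, Int.modEq_one,
      and_true, jacobiSym.pow_right, hu]
    push_cast
    by_cases h1 : α % p = t ^ 2 % p <;> simp [h1]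
  have hwp : ∀ α, charWeight r h t (p ^ k) α = charWeight r h t (p ^ k) (α % p) := fun α => by
    rw [hw, hw, Nat.mod_mod, ← hup]
  have hpk : p ^ k = p * p ^ (k - 1) := by rw [← pow_succ', Nat.sub_add_cancel (by omega)]
  have hr : ∑ α ∈ Finset.range (p ^ k), charWeight r h t (p ^ k) α
      = ∑ α ∈ Finset.range (p * p ^ (k - 1)), charWeight r h t (p ^ k) α := by rw [← hpk]
  rw [charSum_eq, hr, sum_range_mul_of_periodic hwp]
  push_cast
  congr 1
  simp only [hw]
  rw [Finset.sum_sub_distrib, sum_jacobiSym_pow hp hp2 hk]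
  congr 1
  have h1 : ∀ α ∈ Finset.range p, (if α % p = t ^ 2 % p then u α else 0)
      = if α = t ^ 2 % p then u α else 0 := fun α hα => by
    rw [Nat.mod_eq_of_lt (Finset.mem_range.mp hα)]
  rw [Finset.sum_congr rfl h1, Finset.sum_ite_eq' , if_pos (by simp [Nat.mod_lt _ hp.pos]), ← hup]
  simp only [hu]
  push_cast
  rw [jacobiSym.pow_left, jacobiSym_sq_prime hp]
  simp only [Int.natCast_dvd_natCast]
  split_ifs <;> simp [hk]

lemma charSum_prime_pow_of_dvd {r : ℤ} {h p k t : ℕ} (hp : p.Prime)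
    (hph : p ∣ h) (hk : k ≠ 0) (ht : ¬ (p : ℤ) ∣ (t : ℤ) ^ 2 - r) :
    charSum r h t (p ^ k) * Nat.gcd (p ^ k) h = (p : ℝ) ^ k * (jacobiSym r p : ℝ) ^ k := by
  set g := Nat.gcd (p ^ k) h with hg
  have hpg : p ∣ g := Nat.dvd_gcd (dvd_pow_self p hk) hph
  obtain ⟨b, hb⟩ : g ∣ p ^ k := Nat.gcd_dvd_left _ _
  have hg0 : 0 < g := Nat.gcd_pos_of_pos_left _ (pow_pos hp.pos k)
  set u : ℕ → ℝ := fun α => if (α : ℤ) ≡ r [ZMOD (g : ℤ)] then 1 else 0 with hu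
  have hup : ∀ a, u a = u (a % g) := fun a => by
    have h1 : (a : ℤ) ≡ ((a % g : ℕ) : ℤ) [ZMOD g] := by
      push_cast
      exact (Int.mod_modEq _ _).symm
    have h2 : ((a : ℤ) ≡ r [ZMOD (g : ℤ)]) ↔ (((a % g : ℕ) : ℤ) ≡ r [ZMOD (g : ℤ)]) :=
      ⟨fun h => h1.symm.trans h, fun h => h1.trans h⟩
    simp only [hu, h2]
  have hw : ∀ α, charWeight r h t (p ^ k) α = (jacobiSym r p : ℝ) ^ k * u α := by
    intro α
    simp only [charWeight, ← hg, gcd_prime_pow_eq_one_iff hp hk, hu]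
    by_cases h1 : (α : ℤ) ≡ r [ZMOD (g : ℤ)]
    · have h2 : (α : ℤ) ≡ r [ZMOD (p : ℤ)] := h1.of_dvd (by exact_mod_cast hpg)
      have h3 : ¬ (p : ℤ) ∣ (t : ℤ) ^ 2 - α := fun h4 => ht (by
        have := dvd_add h4 (h2.symm.dvd)
        simpa using this)
      rw [if_pos ⟨h3, h1⟩, if_pos h1, jacobiSym.pow_right, jacobiSym.mod_left' h2]
      push_cast
      ring
    · rw [if_neg (fun h => h1 h.2), if_neg h1, mul_zero]
  rw [charSum_eq]
  simp only [hw]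
  have hone : ∑ α ∈ Finset.range g, u α = 1 := by
    have hgz : (0 : ℤ) < g := by exact_mod_cast hg0
    have h1 : ∀ α ∈ Finset.range g, u α = if α = (r % g).toNat then 1 else 0 := by
      intro α hα
      have h2 : ((α : ℤ) ≡ r [ZMOD (g : ℤ)]) ↔ α = (r % g).toNat := by
        have h3 : (α : ℤ) % g = α :=
          Int.emod_eq_of_lt (by positivity) (by exact_mod_cast Finset.mem_range.mp hα)
        have := Int.emod_nonneg r hgz.ne'
        rw [Int.ModEq, h3]
        omega
      simp only [hu, h2]
    rw [Finset.sum_congr rfl h1, Finset.sum_ite_eq', if_pos]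
    have := Int.emod_nonneg r hgz.ne'
    have := Int.emod_lt_of_pos r hgz
    rw [Finset.mem_range]
    omega
  have hr : ∑ α ∈ Finset.range (p ^ k), (jacobiSym r p : ℝ) ^ k * u α
      = (jacobiSym r p : ℝ) ^ k * b := by
    rw [← Finset.mul_sum, hb, sum_range_mul_of_periodic hup, hone, mul_one]
  rw [hr]
  have : (p : ℝ) ^ k = g * b := by exact_mod_cast hb
  rw [this]
  ring

/-- The contribution of the prime `p` to `charSum` at `p ^ k`, after normalization. -/
def charLocal (r : ℤ) (h p k : ℕ) : ℝ :=
  if p = 2 then 0 else if p ∣ h then (jacobiSym r p : ℝ) ^ k / (p : ℝ) ^ k else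
    if Even k then ((p : ℝ) - 2) / ((p : ℝ) ^ k * ((p : ℝ) - 1))
    else -1 / ((p : ℝ) ^ k * ((p : ℝ) - 1))

/-- The correction to `charLocal` for the primes dividing `t`. -/
def charLocalDiv (h p k : ℕ) : ℝ :=
  if p ∣ 2 * h then 0 else 1 / ((p : ℝ) ^ k * ((p : ℝ) - 1))

/-- The contribution of the prime `p` to the normalized Möbius summand at `p ^ k`. -/
def moebiusLocal (r : ℤ) (h p k : ℕ) : ℝ :=
  if p = 2 ∨ k ≠ 1 then 0 else if p ∣ h then
    (if (p : ℤ) ∣ r ∧ ¬ p ^ 2 ∣ h then -1 / (p : ℝ) else 0)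
    else -1 / ((p : ℝ) * ((p : ℝ) - 1))

/-- The correction to `moebiusLocal` for the primes dividing `t`. -/
def moebiusLocalDiv (h p k : ℕ) : ℝ :=
  if p ∣ 2 * h ∨ k ≠ 1 then 0 else 1 / ((p : ℝ) * ((p : ℝ) - 1))

lemma totient_gcd_mul (h : ℕ) {m n : ℕ} (hmn : Nat.Coprime m n) :
    Nat.totient (Nat.gcd (m * n) h) = Nat.totient (Nat.gcd m h) * Nat.totient (Nat.gcd n h) := by
  rw [Nat.gcd_comm (m * n), Nat.Coprime.gcd_mul h hmn, Nat.gcd_comm h, Nat.gcd_comm h,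
    Nat.totient_mul]
  exact Nat.Coprime.coprime_dvd_left (Nat.gcd_dvd_left _ _)
      (Nat.Coprime.coprime_dvd_right (Nat.gcd_dvd_left _ _) hmn)

lemma totient_mul_prime_of_dvd_pow {p k g : ℕ} (hp : p.Prime) (hg : g ∣ p ^ k) (hpg : p ∣ g) :
    (Nat.totient g : ℝ) * p = g * ((p : ℝ) - 1) := by
  obtain ⟨j, -, rfl⟩ := (Nat.dvd_prime_pow hp).mp hg
  have hj : 0 < j := by
    rcases Nat.eq_zero_or_pos j with rfl | h
    · exact absurd (by simpa using hpg) hp.one_lt.ne'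
    · exact h
  rw [Nat.totient_prime_pow hp hj]
  obtain ⟨i, rfl⟩ : ∃ i, j = i + 1 := ⟨j - 1, by omega⟩
  push_cast [hp.one_le]
  ring

lemma charSum_normalized_eq_mulExt {r : ℤ} {h t n : ℕ} (hn : Odd n)
    (ht : Int.gcd ((t : ℤ) ^ 2 - r) (h : ℤ) = 1) :
    charSum r h t n * Nat.totient (Nat.gcd n h) / (n * Nat.totient n)
      = mulExt (fun p k => charLocal r h p k + if p ∣ t then charLocalDiv h p k else 0) n := by
  refine eq_mulExt (fun n => charSum r h t n * Nat.totient (Nat.gcd n h) / (n * Nat.totient n))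
    ?_ (by simp [charSum_one]) _ hn.pos.ne' ?_
  · intro a b hab
    simp only [charSum_mul r h t a b hab, totient_gcd_mul h hab, Nat.totient_mul hab]
    push_cast
    rw [div_mul_div_comm]
    congr 1 <;> ring
  · intro p hpn k hk
    have hp := Nat.prime_of_mem_primeFactors hpn
    have hp2 : p ≠ 2 := by
      rintro rfl
      exact (Nat.not_even_iff_odd.mpr hn) (even_iff_two_dvd.mpr (Nat.dvd_of_mem_primeFactors hpn))
    have hp1 : (p : ℝ) - 1 ≠ 0 := by
      have : (1 : ℝ) < p := by exact_mod_cast hp.one_lt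
      linarith
    have hp0 : (p : ℝ) ≠ 0 := by exact_mod_cast hp.ne_zero
    have hpd : p ∣ 2 * h ↔ p ∣ h := by
      rw [hp.dvd_mul, Nat.prime_dvd_prime_iff_eq hp Nat.prime_two]
      simp [hp2]
    have htp : (Nat.totient (p ^ k) : ℝ) * p = (p : ℝ) ^ k * ((p : ℝ) - 1) := by
      exact_mod_cast totient_mul_prime_of_dvd_pow hp dvd_rfl (dvd_pow_self p hk)
    have htp' : (Nat.totient (p ^ k) : ℝ) = (p : ℝ) ^ k * ((p : ℝ) - 1) / p := by
      rw [← htp, mul_div_cancel_right₀ _ hp0]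
    simp only [charLocal, charLocalDiv, hp2, if_false, hpd]
    by_cases hph : p ∣ h
    · simp only [hph, if_true, ite_self, add_zero]
      have hnd : ¬ (p : ℤ) ∣ (t : ℤ) ^ 2 - r := fun hd => by
        have := Int.dvd_gcd hd (Int.natCast_dvd_natCast.mpr hph)
        rw [ht] at this
        exact hp.one_lt.ne' (Nat.dvd_one.mp (by exact_mod_cast this))
      have h1 := charSum_prime_pow_of_dvd (t := t) hp hph hk hnd
      have h2 := totient_mul_prime_of_dvd_pow hp (Nat.gcd_dvd_left (p ^ k) h)
        (Nat.dvd_gcd (dvd_pow_self p hk) hph)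
      have h3 : (Nat.totient (Nat.gcd (p ^ k) h) : ℝ)
          = Nat.gcd (p ^ k) h * ((p : ℝ) - 1) / p := by
        rw [← h2, mul_div_cancel_right₀ _ hp0]
      rw [h3, htp', mul_div_assoc', ← mul_assoc, h1]
      push_cast
      field_simp
    · have hg : Nat.gcd (p ^ k) h = 1 :=
        Nat.Coprime.pow_left k ((Nat.Prime.coprime_iff_not_dvd hp).mpr hph)
      rw [charSum_prime_pow_of_not_dvd r t hp hp2 hph hk, hg, htp']
      obtain ⟨j, rfl⟩ : ∃ j, k = j + 1 := ⟨k - 1, by omega⟩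
      simp only [hph, if_false, Nat.totient_one, Nat.add_sub_cancel]
      push_cast
      split_ifs <;> field_simp <;> ring_nf

lemma moebius_normalized_eq_mulExt {r : ℤ} {h t d : ℕ} (hd : Odd d)
    (hsf : Squarefree (Int.gcd r (h : ℤ))) (ht : Int.gcd ((t : ℤ) ^ 2 - r) (h : ℤ) = 1) :
    (ArithmeticFunction.moebius d : ℝ) *
        (if Nat.gcd d t = 1 ∧ (Nat.gcd (d ^ 2) h : ℤ) ∣ r then 1 else 0) *
        Nat.totient (Nat.gcd (d ^ 2) h) / Nat.totient (d ^ 2)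
      = mulExt (fun p k => moebiusLocal r h p k + if p ∣ t then moebiusLocalDiv h p k else 0) d := by
  refine eq_mulExt (fun d => (ArithmeticFunction.moebius d : ℝ) *
        (if Nat.gcd d t = 1 ∧ (Nat.gcd (d ^ 2) h : ℤ) ∣ r then 1 else 0) *
        Nat.totient (Nat.gcd (d ^ 2) h) / Nat.totient (d ^ 2)) ?_ (by simp) _ hd.pos.ne' ?_
  · intro a b hab
    have hab2 : Nat.Coprime (a ^ 2) (b ^ 2) := hab.pow 2 2
    have h1 : (Nat.gcd (a * b) t = 1 ∧ (Nat.gcd ((a * b) ^ 2) h : ℤ) ∣ r)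
        ↔ (Nat.gcd a t = 1 ∧ (Nat.gcd (a ^ 2) h : ℤ) ∣ r) ∧
          (Nat.gcd b t = 1 ∧ (Nat.gcd (b ^ 2) h : ℤ) ∣ r) := by
      have h2 : Nat.gcd (a * b) t = 1 ↔ Nat.gcd a t = 1 ∧ Nat.gcd b t = 1 :=
        Nat.coprime_mul_iff_left
      have h3 : (Nat.gcd ((a * b) ^ 2) h : ℤ) ∣ r
          ↔ (Nat.gcd (a ^ 2) h : ℤ) ∣ r ∧ (Nat.gcd (b ^ 2) h : ℤ) ∣ r := by
        rw [mul_pow, Nat.gcd_comm (a ^ 2 * b ^ 2), Nat.Coprime.gcd_mul h hab2, Nat.gcd_comm h,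
          Nat.gcd_comm h]
        push_cast
        have hc : IsCoprime ((Nat.gcd (a ^ 2) h : ℕ) : ℤ) ((Nat.gcd (b ^ 2) h : ℕ) : ℤ) := by
          rw [Nat.isCoprime_iff_coprime]
          exact Nat.Coprime.coprime_dvd_left (Nat.gcd_dvd_left _ _)
            (Nat.Coprime.coprime_dvd_right (Nat.gcd_dvd_left _ _) hab2)
        exact ⟨fun h => ⟨dvd_of_mul_right_dvd h, dvd_of_mul_left_dvd h⟩,
          fun h => hc.mul_dvd h.1 h.2⟩
      rw [h2, h3]
      tauto
    have h4 : (if Nat.gcd (a * b) t = 1 ∧ (Nat.gcd ((a * b) ^ 2) h : ℤ) ∣ r then (1 : ℝ) else 0)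
        = (if Nat.gcd a t = 1 ∧ (Nat.gcd (a ^ 2) h : ℤ) ∣ r then 1 else 0) *
          (if Nat.gcd b t = 1 ∧ (Nat.gcd (b ^ 2) h : ℤ) ∣ r then 1 else 0) := by
      rw [if_congr h1 rfl rfl, ite_and, ite_mul, one_mul, zero_mul]
    rw [h4]
    simp only [mul_pow, totient_gcd_mul h hab2, Nat.totient_mul hab2,
      ArithmeticFunction.isMultiplicative_moebius.map_mul_of_coprime hab]
    push_cast
    rw [div_mul_div_comm]
    congr 1
    ring
  · intro p hpn k hk
    have hp := Nat.prime_of_mem_primeFactors hpn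
    have hp2 : p ≠ 2 := by
      rintro rfl
      exact (Nat.not_even_iff_odd.mpr hd) (even_iff_two_dvd.mpr (Nat.dvd_of_mem_primeFactors hpn))
    have hp1 : (p : ℝ) - 1 ≠ 0 := by
      have : (1 : ℝ) < p := by exact_mod_cast hp.one_lt
      linarith
    have hp0 : (p : ℝ) ≠ 0 := by exact_mod_cast hp.ne_zero
    by_cases hk1 : k = 1
    swap
    · have h0 : ArithmeticFunction.moebius (p ^ k) = 0 := by
        rw [ArithmeticFunction.moebius_apply_prime_pow hp hk, if_neg hk1]
      simp [h0, moebiusLocal, moebiusLocalDiv, hk1]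
    subst hk1
    have hpd : p ∣ 2 * h ↔ p ∣ h := by
      rw [hp.dvd_mul, Nat.prime_dvd_prime_iff_eq hp Nat.prime_two]
      simp [hp2]
    have htp : (Nat.totient (p ^ 2) : ℝ) = p * ((p : ℝ) - 1) := by
      rw [Nat.totient_prime_pow hp two_pos]
      push_cast [hp.one_le]
      ring
    have hcop : Nat.gcd p t = 1 ↔ ¬ p ∣ t := Nat.Prime.coprime_iff_not_dvd hp
    simp only [moebiusLocal, moebiusLocalDiv, pow_one, ArithmeticFunction.moebius_apply_prime hp,
      hpd, hp2, htp, hcop, ne_eq, not_true_eq_false, or_false, if_false]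
    by_cases hph : p ∣ h
    · simp only [hph, if_true, ite_self, add_zero]
      have hpg : p ∣ Nat.gcd (p ^ 2) h := Nat.dvd_gcd (dvd_pow_self p two_ne_zero) hph
      by_cases hpr : (p : ℤ) ∣ r
      · have hpt : ¬ p ∣ t := fun hd => by
          have h1 : (p : ℤ) ∣ (t : ℤ) ^ 2 - r :=
            dvd_sub (dvd_pow (Int.natCast_dvd_natCast.mpr hd) two_ne_zero) hpr
          have := Int.dvd_gcd h1 (Int.natCast_dvd_natCast.mpr hph)
          rw [ht] at this
          exact hp.one_lt.ne' (Nat.dvd_one.mp (by exact_mod_cast this))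
        by_cases hp2h : p ^ 2 ∣ h
        · have h1 : ¬ ((p ^ 2 : ℕ) : ℤ) ∣ r := fun h1 => by
            have h2 := Int.dvd_gcd h1 (Int.natCast_dvd_natCast.mpr hp2h)
            have h3 : p * p ∣ Int.gcd r h := by
              rw [← pow_two]
              exact_mod_cast h2
            exact hp.one_lt.ne' (Nat.isUnit_iff.mp (hsf p h3))
          rw [Nat.gcd_eq_left hp2h]
          simp only [h1, hp2h]
          simp
        · have h1 : Nat.gcd (p ^ 2) h = p := by
            obtain ⟨j, hj, hj'⟩ := (Nat.dvd_prime_pow hp).mp (Nat.gcd_dvd_left (p ^ 2) h)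
            have hj2 : j ≠ 2 := fun h2 => hp2h (by
              rw [h2] at hj'
              rw [← hj']
              exact Nat.gcd_dvd_right _ _)
            have hj0 : j ≠ 0 := fun h2 => by
              rw [h2, pow_zero] at hj'
              rw [hj'] at hpg
              exact hp.one_lt.ne' (Nat.dvd_one.mp hpg)
            rw [hj', show j = 1 by omega, pow_one]
          simp only [h1, hpr, hpt, hp2h, Nat.totient_prime hp, not_false_eq_true, and_self, if_true]
          push_cast [hp.one_le]
          field_simp
      · have h1 : ¬ (Nat.gcd (p ^ 2) h : ℤ) ∣ r := fun h1 =>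
          hpr ((Int.natCast_dvd_natCast.mpr hpg).trans h1)
        simp [h1, hpr]
    · have hg : Nat.gcd (p ^ 2) h = 1 :=
        Nat.Coprime.pow_left 2 ((Nat.Prime.coprime_iff_not_dvd hp).mpr hph)
      simp only [hph, hg, if_false]
      by_cases hpt : p ∣ t
      · simp [hpt]
        field_simp
        ring
      · simp [hpt]

lemma mulExt_eq_zero_of_not_odd {φ : ℕ → ℕ → ℝ} (h2 : ∀ k, φ 2 k = 0) {n : ℕ} (hn : ¬ Odd n) :
    mulExt φ n = 0 := by
  rcases eq_or_ne n 0 with rfl | h0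
  · simp
  rw [mulExt_of_ne_zero _ h0]
  refine Finset.prod_eq_zero (i := 2) ?_ (h2 _)
  exact Nat.mem_primeFactors.mpr
    ⟨Nat.prime_two, even_iff_two_dvd.mp (Nat.not_odd_iff_even.mp hn), h0⟩

lemma totient_gcd_mul_totient_lcm (m n : ℕ) :
    Nat.totient (Nat.gcd m n) * Nat.totient (Nat.lcm m n) = Nat.totient m * Nat.totient n := by
  have hm : ArithmeticFunction.IsMultiplicative (⟨Nat.totient, Nat.totient_zero⟩ :
      ArithmeticFunction ℕ) := ⟨Nat.totient_one, fun h => Nat.totient_mul h⟩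
  have := hm.lcm_apply_mul_gcd_apply (x := m) (y := n)
  rw [mul_comm]
  exact this

lemma totient_lcm_mul_sq (h : ℕ) {n d : ℕ} (hnd : Nat.Coprime n d) :
    Nat.totient (Nat.gcd n h) * Nat.totient (Nat.gcd (d ^ 2) h)
        * Nat.totient (Nat.lcm (n * d ^ 2) h)
      = Nat.totient n * Nat.totient (d ^ 2) * Nat.totient h := by
  have hnd2 : Nat.Coprime n (d ^ 2) := hnd.pow_right 2
  rw [← totient_gcd_mul h hnd2, totient_gcd_mul_totient_lcm, Nat.totient_mul hnd2]

/-- The mean over `t` of the local factor of the normalized character sum. -/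
def charMean (r : ℤ) (h p k : ℕ) : ℝ := charLocal r h p k + charLocalDiv h p k / p

/-- The mean over `t` of the local factor of the normalized Möbius summand. -/
def moebiusMean (r : ℤ) (h p k : ℕ) : ℝ := moebiusLocal r h p k + moebiusLocalDiv h p k / p

/-- The local factor of the normalized character sum for a given `t`. -/
def charFactor (r : ℤ) (h t p k : ℕ) : ℝ :=
  charLocal r h p k + if p ∣ t then charLocalDiv h p k else 0

/-- The local factor of the normalized Möbius summand for a given `t`. -/
def moebiusFactor (r : ℤ) (h t p k : ℕ) : ℝ :=
  moebiusLocal r h p k + if p ∣ t then moebiusLocalDiv h p k else 0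

lemma charFactor_two (r : ℤ) (h t k : ℕ) : charFactor r h t 2 k = 0 := by
  simp [charFactor, charLocal, charLocalDiv]

lemma moebiusFactor_two (r : ℤ) (h t k : ℕ) : moebiusFactor r h t 2 k = 0 := by
  simp [moebiusFactor, moebiusLocal, moebiusLocalDiv]

lemma summand_eq {r : ℤ} {h t n d : ℕ} (hpos : 0 < h)
    (hsf : Squarefree (Int.gcd r (h : ℤ))) (ht : Int.gcd ((t : ℤ) ^ 2 - r) (h : ℤ) = 1) :
    (if Odd n then 1 / (n : ℝ) * (charSum r h t n *
        if Odd d ∧ Nat.gcd d (n * t) = 1 ∧ ((Nat.gcd (d ^ 2) h : ℤ) ∣ r) then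
          (ArithmeticFunction.moebius d : ℝ) / (Nat.totient (Nat.lcm (n * d ^ 2) h) : ℝ)
        else 0) else 0)
      = 1 / Nat.totient h * if Nat.Coprime n d then
          mulExt (charFactor r h t) n * mulExt (moebiusFactor r h t) d else 0 := by
  by_cases hn : Odd n
  swap
  · rw [if_neg hn, mulExt_eq_zero_of_not_odd (charFactor_two r h t) hn]
    simp
  rw [if_pos hn]
  by_cases hd : Odd d
  swap
  · rw [if_neg (fun h => hd h.1), mulExt_eq_zero_of_not_odd (moebiusFactor_two r h t) hd]
    simp
  have hgcd : Nat.gcd d (n * t) = 1 ↔ Nat.Coprime n d ∧ Nat.gcd d t = 1 := by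
    rw [Nat.coprime_comm]
    exact Nat.coprime_mul_iff_right
  by_cases hnd : Nat.Coprime n d
  swap
  · rw [if_neg (fun h => hnd (hgcd.mp h.2.1).1), if_neg hnd]
    simp
  have e1 : mulExt (charFactor r h t) n
      = charSum r h t n * Nat.totient (Nat.gcd n h) / (n * Nat.totient n) :=
    (charSum_normalized_eq_mulExt hn ht).symm
  have e2 := (moebius_normalized_eq_mulExt hd hsf ht).symm
  rw [if_pos hnd, e1, show mulExt (moebiusFactor r h t) d = _ from e2]
  have e3 : (Nat.totient (Nat.gcd n h) : ℝ) * Nat.totient (Nat.gcd (d ^ 2) h)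
        * Nat.totient (Nat.lcm (n * d ^ 2) h)
      = Nat.totient n * Nat.totient (d ^ 2) * Nat.totient h := by
    exact_mod_cast totient_lcm_mul_sq h hnd
  have hphi : ∀ m : ℕ, 0 < m → (Nat.totient m : ℝ) ≠ 0 := fun m hm => by
    exact_mod_cast (Nat.totient_pos.mpr hm).ne'
  have z1 := hphi h hpos
  have z2 := hphi n hn.pos
  have z3 := hphi (d ^ 2) (pow_pos hd.pos 2)
  have z4 := hphi (Nat.lcm (n * d ^ 2) h)
    (Nat.lcm_pos (Nat.mul_pos hn.pos (pow_pos hd.pos 2)) hpos)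
  have z5 : (n : ℝ) ≠ 0 := by exact_mod_cast hn.pos.ne'
  by_cases hc : Nat.gcd d t = 1 ∧ (Nat.gcd (d ^ 2) h : ℤ) ∣ r
  · rw [if_pos ⟨hd, hgcd.mpr ⟨hnd, hc.1⟩, hc.2⟩, if_pos hc]
    field_simp
    linear_combination (-charSum r h t n * (ArithmeticFunction.moebius d : ℝ)) * e3
  · rw [if_neg (fun h => hc ⟨(hgcd.mp h.2.1).2, h.2.2⟩), if_neg hc]
    simp

lemma Ssum_eq {r : ℤ} {h : ℕ} (hpos : 0 < h) (hsf : Squarefree (Int.gcd r (h : ℤ)))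
    (T U R : ℝ) :
    Ssum r h T U R = 1 / Nat.totient h * ∑ n ∈ Finset.Icc 1 ⌊U⌋₊, ∑ d ∈ Finset.Icc 1 ⌊R⌋₊,
      if Nat.Coprime n d then
        ∑ t ∈ (Finset.Icc 1 ⌊T⌋₊).filter
            (fun t : ℕ => Odd t ∧ Int.gcd ((t : ℤ) ^ 2 - r) (h : ℤ) = 1),
          mulExt (charFactor r h t) n * mulExt (moebiusFactor r h t) d
      else 0 := by
  have h1 : ∀ t ∈ (Finset.Icc 1 ⌊T⌋₊).filter
      (fun t : ℕ => Odd t ∧ Int.gcd ((t : ℤ) ^ 2 - r) (h : ℤ) = 1),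
      (∑ n ∈ (Finset.Icc 1 ⌊U⌋₊).filter (fun n : ℕ => Odd n), (1 / (n : ℝ)) *
        ∑ α ∈ (Finset.range n).filter
            (fun α : ℕ => Int.gcd ((t : ℤ) ^ 2 - (α : ℤ)) (n : ℤ) = 1 ∧
              (α : ℤ) ≡ r [ZMOD (Nat.gcd n h : ℤ)]),
          (jacobiSym (α : ℤ) n : ℝ) *
            ∑ d ∈ (Finset.Icc 1 ⌊R⌋₊).filter
                (fun d : ℕ => Odd d ∧ Nat.gcd d (n * t) = 1 ∧
                  ((Nat.gcd (d ^ 2) h : ℤ) ∣ r)),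
              (ArithmeticFunction.moebius d : ℝ) /
                (Nat.totient (Nat.lcm (n * d ^ 2) h) : ℝ))
        = 1 / Nat.totient h * ∑ n ∈ Finset.Icc 1 ⌊U⌋₊, ∑ d ∈ Finset.Icc 1 ⌊R⌋₊,
            if Nat.Coprime n d then
              mulExt (charFactor r h t) n * mulExt (moebiusFactor r h t) d else 0 := by
    intro t ht
    have ht' := (Finset.mem_filter.mp ht).2.2
    rw [Finset.sum_filter, Finset.mul_sum]
    refine Finset.sum_congr rfl fun n _ => ?_
    have e := Finset.sum_congr rfl fun d (_ : d ∈ Finset.Icc 1 ⌊R⌋₊) =>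
      summand_eq (n := n) (d := d) hpos hsf ht'
    rw [← Finset.mul_sum] at e
    rw [← e, ← Finset.sum_mul, ← charSum, Finset.sum_filter]
    split_ifs with hn
    · rw [Finset.mul_sum, Finset.mul_sum]
    · simp
  rw [Ssum, Finset.sum_congr rfl h1, ← Finset.mul_sum, Finset.sum_comm]
  congr 1
  refine Finset.sum_congr rfl fun n _ => ?_
  rw [Finset.sum_comm]
  refine Finset.sum_congr rfl fun d _ => ?_
  split_ifs <;> simp

lemma prod_primeFactors_mul_of_coprime (φ ψ : ℕ → ℕ → ℝ) {n d : ℕ} (hn : n ≠ 0) (hd : d ≠ 0)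
    (hnd : Nat.Coprime n d) :
    ∏ p ∈ (n * d).primeFactors,
        (if p ∣ n then φ p (n.factorization p) else ψ p (d.factorization p))
      = mulExt φ n * mulExt ψ d := by
  rw [hnd.primeFactors_mul, Finset.prod_union hnd.disjoint_primeFactors,
    mulExt_of_ne_zero _ hn, mulExt_of_ne_zero _ hd]
  congr 1
  · exact Finset.prod_congr rfl fun p hp => if_pos (Nat.dvd_of_mem_primeFactors hp)
  · refine Finset.prod_congr rfl fun p hp => if_neg fun hpn => ?_
    exact (Nat.prime_of_mem_primeFactors hp).one_lt.ne'
      (Nat.eq_one_of_dvd_coprimes hnd hpn (Nat.dvd_of_mem_primeFactors hp))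

lemma abs_sum_mulExt_sub_le {r : ℤ} {h : ℕ} (hpos : 0 < h) (hodd : Odd h) {n d : ℕ}
    (hn : n ≠ 0) (hd : d ≠ 0) (hnd : Nat.Coprime n d) {T : ℝ} (hT : 0 ≤ T) :
    |∑ t ∈ (Finset.Icc 1 ⌊T⌋₊).filter
          (fun t : ℕ => Odd t ∧ Int.gcd ((t : ℤ) ^ 2 - r) (h : ℤ) = 1),
          mulExt (charFactor r h t) n * mulExt (moebiusFactor r h t) d
        - T * (unitCount r h / (2 * h)) * (mulExt (charMean r h) n * mulExt (moebiusMean r h) d)|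
      ≤ (2 * h + 1) * (mulExt (fun p k => |charLocal r h p k| + |charLocalDiv h p k|) n *
          mulExt (fun p k => |moebiusLocal r h p k| + |moebiusLocalDiv h p k|) d) := by
  set X : ℕ → ℝ := fun p =>
    if p ∣ n then charLocal r h p (n.factorization p) else moebiusLocal r h p (d.factorization p)
    with hX
  set Y : ℕ → ℝ := fun p =>
    if p ∣ n then charLocalDiv h p (n.factorization p) else moebiusLocalDiv h p (d.factorization p)
    with hY
  have key := abs_sum_prod_sub_le (r := r) hpos hodd (P := (n * d).primeFactors)
    (fun p hp => Nat.prime_of_mem_primeFactors hp) (X := X) (Y := Y)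
    (fun p _ hp2 => by simp [hY, charLocalDiv, moebiusLocalDiv, hp2]) hT
  have e1 : ∀ t : ℕ, ∏ p ∈ (n * d).primeFactors, (X p + if p ∣ t then Y p else 0)
      = mulExt (charFactor r h t) n * mulExt (moebiusFactor r h t) d := fun t => by
    rw [← prod_primeFactors_mul_of_coprime _ _ hn hd hnd]
    refine Finset.prod_congr rfl fun p _ => ?_
    simp only [hX, hY, charFactor, moebiusFactor]
    by_cases hpn : p ∣ n <;> simp [hpn]
  have e2 : ∏ p ∈ (n * d).primeFactors, (X p + Y p / p)
      = mulExt (charMean r h) n * mulExt (moebiusMean r h) d := by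
    rw [← prod_primeFactors_mul_of_coprime _ _ hn hd hnd]
    refine Finset.prod_congr rfl fun p _ => ?_
    simp only [hX, hY, charMean, moebiusMean]
    by_cases hpn : p ∣ n <;> simp [hpn]
  have e3 : ∏ p ∈ (n * d).primeFactors, (|X p| + |Y p|)
      = mulExt (fun p k => |charLocal r h p k| + |charLocalDiv h p k|) n *
          mulExt (fun p k => |moebiusLocal r h p k| + |moebiusLocalDiv h p k|) d := by
    rw [← prod_primeFactors_mul_of_coprime _ _ hn hd hnd]
    refine Finset.prod_congr rfl fun p _ => ?_
    simp only [hX, hY]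
    by_cases hpn : p ∣ n <;> simp [hpn]
  rw [Finset.sum_congr rfl fun t _ => e1 t, e2, e3] at key
  exact key

lemma div_pow_max_two_of_odd {p k : ℕ} (hp : 3 ≤ p) {c : ℝ} (hc : 4 ≤ c) (hk : Odd k) :
    2 / ((p : ℝ) ^ k * ((p : ℝ) - 1)) ≤ c / (p : ℝ) ^ (max k 2) := by
  have hp3 : (3 : ℝ) ≤ p := by exact_mod_cast hp
  rw [div_le_div_iff₀ (mul_pos (by positivity) (by linarith)) (by positivity)]
  obtain ⟨j, rfl⟩ := hk
  rcases Nat.eq_zero_or_pos j with rfl | hj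
  · norm_num
    nlinarith [mul_le_mul_of_nonneg_right hc (show (0 : ℝ) ≤ p * (p - 1) by nlinarith)]
  · rw [max_eq_left (by omega)]
    have : (0 : ℝ) < (p : ℝ) ^ (2 * j + 1) := by positivity
    nlinarith [mul_nonneg this.le (show 0 ≤ c * (p - 1) - 2 by nlinarith)]

lemma one_div_pow_le_div_pow_max_two {p h k : ℕ} (hp : p.Prime) (hpos : 0 < h) (hph : p ∣ h)
    (hk : k ≠ 0) : 1 / (p : ℝ) ^ k ≤ (4 + h) / (p : ℝ) ^ (max k 2) := by
  have hp0 : (0 : ℝ) < p := by exact_mod_cast hp.pos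
  have hle : (p : ℝ) ≤ h := by exact_mod_cast Nat.le_of_dvd hpos hph
  rw [div_le_div_iff₀ (by positivity) (by positivity)]
  rcases Nat.lt_or_ge k 2 with hk2 | hk2
  · rw [show k = 1 by omega]
    norm_num
    nlinarith
  · rw [max_eq_left hk2]
    have : (0 : ℝ) < (p : ℝ) ^ k := by positivity
    nlinarith

lemma prime_dvd_two_mul_iff {p h : ℕ} (hp : p.Prime) (hp2 : p ≠ 2) : p ∣ 2 * h ↔ p ∣ h := by
  rw [hp.dvd_mul, Nat.prime_dvd_prime_iff_eq hp Nat.prime_two]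
  simp [hp2]

lemma abs_jacobiSym_le_one (a : ℤ) (n : ℕ) : |(jacobiSym a n : ℝ)| ≤ 1 := by
  rcases jacobiSym.trichotomy a n with h | h | h <;> simp [h]

lemma abs_charLocal_add_le (r : ℤ) {h p k : ℕ} (hpos : 0 < h) (hp : p.Prime) (hk : k ≠ 0) :
    |charLocal r h p k| + |charLocalDiv h p k| ≤ (4 + h) / (p : ℝ) ^ (max k 2) := by
  have hc : (4 : ℝ) ≤ 4 + h := by simp
  by_cases hp2 : p = 2
  · subst hp2
    simp only [charLocal, charLocalDiv, if_true, dvd_mul_right, abs_zero, add_zero]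
    positivity
  have hp3 : 3 ≤ p := by
    have := hp.two_le
    omega
  have hp3' : (3 : ℝ) ≤ p := by exact_mod_cast hp3
  have hpp : (0 : ℝ) < (p : ℝ) ^ k * ((p : ℝ) - 1) := mul_pos (by positivity) (by linarith)
  simp only [charLocal, charLocalDiv, hp2, if_false, prime_dvd_two_mul_iff hp hp2]
  by_cases hph : p ∣ h
  · simp only [hph, if_true, abs_zero, add_zero]
    refine le_trans ?_ (one_div_pow_le_div_pow_max_two hp hpos hph hk)
    rw [abs_div, abs_pow, abs_of_pos (show (0 : ℝ) < (p : ℝ) ^ k by positivity)]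
    gcongr
    exact pow_le_one₀ (abs_nonneg _) (abs_jacobiSym_le_one r p)
  · simp only [hph, if_false]
    rw [abs_of_pos (div_pos one_pos hpp)]
    split_ifs with hev
    · have hk2 : 2 ≤ k := by
        obtain ⟨j, rfl⟩ := hev
        omega
      rw [abs_of_nonneg (div_nonneg (by linarith) hpp.le), ← add_div, max_eq_left hk2,
        div_le_div_iff₀ hpp (by positivity)]
      nlinarith [mul_nonneg (show (0 : ℝ) ≤ (p : ℝ) ^ k by positivity)
        (show (0 : ℝ) ≤ (3 + h) * ((p : ℝ) - 1) from mul_nonneg (by positivity) (by linarith))]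
    · rw [abs_div, abs_neg, abs_one, abs_of_pos hpp, ← add_div, one_add_one_eq_two]
      exact div_pow_max_two_of_odd hp3 hc (Nat.not_even_iff_odd.mp hev)

lemma abs_moebiusLocal_add_le (r : ℤ) {h p k : ℕ} (hpos : 0 < h) (hp : p.Prime) :
    |moebiusLocal r h p k| + |moebiusLocalDiv h p k| ≤ (4 + h) / (p : ℝ) ^ (max k 2) := by
  have hc : (4 : ℝ) ≤ 4 + h := by simp
  by_cases hk : k = 1
  swap
  · simp only [moebiusLocal, moebiusLocalDiv, ne_eq, hk, not_false_eq_true, or_true, if_true,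
      abs_zero, add_zero]
    positivity
  subst hk
  by_cases hp2 : p = 2
  · subst hp2
    simp only [moebiusLocal, moebiusLocalDiv, true_or, if_true, dvd_mul_right, abs_zero, add_zero]
    positivity
  have hp3 : 3 ≤ p := by
    have := hp.two_le
    omega
  have hp3' : (3 : ℝ) ≤ p := by exact_mod_cast hp3
  have hpp : (0 : ℝ) < (p : ℝ) * ((p : ℝ) - 1) := mul_pos (by positivity) (by linarith)
  simp only [moebiusLocal, moebiusLocalDiv, hp2, ne_eq, not_true_eq_false, or_false, if_false,
    prime_dvd_two_mul_iff hp hp2]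
  by_cases hph : p ∣ h
  · simp only [hph, if_true, abs_zero, add_zero]
    refine le_trans ?_ (one_div_pow_le_div_pow_max_two hp hpos hph one_ne_zero)
    split_ifs
    · rw [abs_div, abs_neg, abs_one, Nat.abs_cast, pow_one]
    · rw [abs_zero]
      positivity
  · simp only [hph, if_false]
    rw [abs_of_pos (div_pos one_pos hpp), abs_div, abs_neg, abs_one, abs_of_pos hpp, ← add_div,
      one_add_one_eq_two]
    simpa using div_pow_max_two_of_odd hp3 hc odd_one

lemma abs_add_div_natCast_le (x y : ℝ) {p : ℕ} (hp : 1 ≤ p) : |x + y / p| ≤ |x| + |y| := by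
  refine (abs_add_le _ _).trans (add_le_add_right ?_ _)
  rw [abs_div, Nat.abs_cast]
  exact div_le_self (abs_nonneg _) (by exact_mod_cast hp)

lemma abs_charMean_le (r : ℤ) {h p k : ℕ} (hpos : 0 < h) (hp : p.Prime) (hk : k ≠ 0) :
    |charMean r h p k| ≤ (4 + h) / (p : ℝ) ^ (max k 2) :=
  (abs_add_div_natCast_le _ _ hp.one_le).trans (abs_charLocal_add_le r hpos hp hk)

lemma abs_moebiusMean_le (r : ℤ) {h p k : ℕ} (hpos : 0 < h) (hp : p.Prime) :
    |moebiusMean r h p k| ≤ (4 + h) / (p : ℝ) ^ (max k 2) :=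
  (abs_add_div_natCast_le _ _ hp.one_le).trans (abs_moebiusLocal_add_le r hpos hp)

lemma moebiusMean_of_ne_one (r : ℤ) (h p : ℕ) {k : ℕ} (hk : k ≠ 1) : moebiusMean r h p k = 0 := by
  simp [moebiusMean, moebiusLocal, moebiusLocalDiv, hk]

lemma moebiusMean_two (r : ℤ) (h k : ℕ) : moebiusMean r h 2 k = 0 := by
  simp [moebiusMean, moebiusLocal, moebiusLocalDiv]

lemma moebiusMean_one_of_dvd (r : ℤ) {h p : ℕ} (hp2 : p ≠ 2) (hph : p ∣ h) :
    moebiusMean r h p 1 = if (p : ℤ) ∣ r ∧ ¬ p ^ 2 ∣ h then -1 / (p : ℝ) else 0 := by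
  simp [moebiusMean, moebiusLocal, moebiusLocalDiv, hp2, hph, Dvd.dvd.mul_left]

lemma moebiusMean_one_of_not_dvd (r : ℤ) {h p : ℕ} (hp : p.Prime) (hp2 : p ≠ 2) (hph : ¬ p ∣ h) :
    moebiusMean r h p 1 = -1 / (p : ℝ) ^ 2 := by
  have hp1 : (p : ℝ) - 1 ≠ 0 := by
    have : (1 : ℝ) < p := by exact_mod_cast hp.one_lt
    linarith
  have hp0 : (p : ℝ) ≠ 0 := by exact_mod_cast hp.ne_zero
  simp only [moebiusMean, moebiusLocal, moebiusLocalDiv, hp2, prime_dvd_two_mul_iff hp hp2, hph,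
    ne_eq, not_true_eq_false, or_false, if_false]
  field_simp
  ring

lemma half_le_one_add_moebiusMean (r : ℤ) {h p : ℕ} (hp : p.Prime) :
    1 / 2 ≤ 1 + moebiusMean r h p 1 := by
  have h2 : (2 : ℝ) ≤ p := by exact_mod_cast hp.two_le
  have h3 : 1 / (p : ℝ) ≤ 1 / 2 := one_div_le_one_div_of_le two_pos h2
  by_cases hp2 : p = 2
  · rw [hp2, moebiusMean_two]
    norm_num
  by_cases hph : p ∣ h
  · rw [moebiusMean_one_of_dvd r hp2 hph]
    split_ifs
    · rw [neg_div]
      linarith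
    · norm_num
  · rw [moebiusMean_one_of_not_dvd r hp hp2 hph, neg_div]
    have : 1 / (p : ℝ) ^ 2 ≤ 1 / 2 := one_div_le_one_div_of_le two_pos (by nlinarith)
    linarith

lemma abs_mulExt_moebiusMean_le (r : ℤ) {h : ℕ} (hpos : 0 < h) (d : ℕ) :
    |mulExt (moebiusMean r h) d| ≤ h * (1 / (d : ℝ) ^ 2) := by
  rcases eq_or_ne d 0 with rfl | hd
  · simp
  have e := eq_mulExt (fun n => (Nat.gcd n h : ℝ) * (1 / (n : ℝ) ^ 2)) (fun m n hmn => by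
      rw [Nat.gcd_comm (m * n), Nat.Coprime.gcd_mul h hmn, Nat.gcd_comm h, Nat.gcd_comm h]
      push_cast
      field_simp) (by simp)
      (fun p k => (Nat.gcd (p ^ k) h : ℝ) * (1 / ((p ^ k : ℕ) : ℝ) ^ 2)) hd
      (fun p _ k _ => rfl)
  refine (abs_mulExt_le (ψ := fun p k => (Nat.gcd (p ^ k) h : ℝ) * (1 / ((p ^ k : ℕ) : ℝ) ^ 2))
    ?_ d).trans ?_
  · intro p k hp _
    have hp0 : (0 : ℝ) < p := by exact_mod_cast hp.pos
    by_cases hk : k = 1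
    swap
    · rw [moebiusMean_of_ne_one _ _ _ hk, abs_zero]
      positivity
    subst hk
    by_cases hp2 : p = 2
    · rw [hp2, moebiusMean_two, abs_zero]
      positivity
    rw [pow_one]
    by_cases hph : p ∣ h
    · rw [moebiusMean_one_of_dvd r hp2 hph, Nat.gcd_eq_left hph]
      split_ifs
      · rw [abs_div, abs_neg, abs_one, Nat.abs_cast]
        apply le_of_eq
        field_simp
      · rw [abs_zero]
        positivity
    · rw [moebiusMean_one_of_not_dvd r hp hp2 hph, abs_div, abs_neg, abs_one,
        abs_of_pos (by positivity), (Nat.Prime.coprime_iff_not_dvd hp).mpr hph]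
      simp
  · rw [← e]
    gcongr
    exact Nat.le_of_dvd hpos (Nat.gcd_dvd_right d h)

lemma abs_Ssum_sub_le {r : ℤ} {h : ℕ} (hpos : 0 < h) (hodd : Odd h)
    (hsf : Squarefree (Int.gcd r (h : ℤ))) {T : ℝ} (hT : 0 ≤ T) (U R : ℝ) :
    |Ssum r h T U R - T * (unitCount r h / (2 * h * Nat.totient h)) *
        ∑ n ∈ Finset.Icc 1 ⌊U⌋₊, ∑ d ∈ Finset.Icc 1 ⌊R⌋₊,
          if Nat.Coprime n d then mulExt (charMean r h) n * mulExt (moebiusMean r h) d else 0|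
      ≤ (2 * h + 1) * (∑' n, majorant (4 + h) n) ^ 2 := by
  set M := ∑' n, majorant (4 + h : ℝ) n with hM
  have hc : (0 : ℝ) ≤ 4 + h := by positivity
  have hm0 := majorant_nonneg hc
  have hpart : ∀ N : ℕ, ∑ n ∈ Finset.Icc 1 N, majorant (4 + h : ℝ) n ≤ M := fun N =>
    (summable_majorant hc).sum_le_tsum _ fun n _ => hm0 n
  have hphi : (1 : ℝ) ≤ Nat.totient h := by exact_mod_cast Nat.totient_pos.mpr hpos
  have e : Ssum r h T U R - T * (unitCount r h / (2 * h * Nat.totient h)) *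
        ∑ n ∈ Finset.Icc 1 ⌊U⌋₊, ∑ d ∈ Finset.Icc 1 ⌊R⌋₊,
          (if Nat.Coprime n d then mulExt (charMean r h) n * mulExt (moebiusMean r h) d else 0)
      = 1 / Nat.totient h * ∑ n ∈ Finset.Icc 1 ⌊U⌋₊, ∑ d ∈ Finset.Icc 1 ⌊R⌋₊,
        if Nat.Coprime n d then
          ∑ t ∈ (Finset.Icc 1 ⌊T⌋₊).filter
            (fun t : ℕ => Odd t ∧ Int.gcd ((t : ℤ) ^ 2 - r) (h : ℤ) = 1),
            mulExt (charFactor r h t) n * mulExt (moebiusFactor r h t) d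
          - T * (unitCount r h / (2 * h)) * (mulExt (charMean r h) n * mulExt (moebiusMean r h) d)
        else 0 := by
    rw [Ssum_eq hpos hsf, show T * (unitCount r h / (2 * h * Nat.totient h))
      = 1 / Nat.totient h * (T * (unitCount r h / (2 * h))) by field_simp, mul_assoc, ← mul_sub]
    congr 1
    rw [Finset.mul_sum, ← Finset.sum_sub_distrib]
    refine Finset.sum_congr rfl fun n _ => ?_
    rw [Finset.mul_sum, ← Finset.sum_sub_distrib]
    refine Finset.sum_congr rfl fun d _ => ?_
    split_ifs <;> simp
  have hbound : ∀ n ∈ Finset.Icc 1 ⌊U⌋₊, ∀ d ∈ Finset.Icc 1 ⌊R⌋₊,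
      |if Nat.Coprime n d then
          ∑ t ∈ (Finset.Icc 1 ⌊T⌋₊).filter
            (fun t : ℕ => Odd t ∧ Int.gcd ((t : ℤ) ^ 2 - r) (h : ℤ) = 1),
            mulExt (charFactor r h t) n * mulExt (moebiusFactor r h t) d
          - T * (unitCount r h / (2 * h)) * (mulExt (charMean r h) n * mulExt (moebiusMean r h) d)
        else 0| ≤ (2 * h + 1) * (majorant (4 + h) n * majorant (4 + h) d) := by
    intro n hn d hd
    split_ifs with hnd
    · refine (abs_sum_mulExt_sub_le hpos hodd ?_ ?_ hnd hT).trans ?_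
      · exact Nat.one_le_iff_ne_zero.mp (Finset.mem_Icc.mp hn).1
      · exact Nat.one_le_iff_ne_zero.mp (Finset.mem_Icc.mp hd).1
      · refine mul_le_mul_of_nonneg_left (mul_le_mul ?_ ?_ ?_ (hm0 n)) (by positivity)
        · refine (le_abs_self _).trans (abs_mulExt_le (fun p k hp hk => ?_) n)
          rw [abs_of_nonneg (by positivity)]
          exact abs_charLocal_add_le r hpos hp hk
        · refine (le_abs_self _).trans (abs_mulExt_le (fun p k hp hk => ?_) d)
          rw [abs_of_nonneg (by positivity)]
          exact abs_moebiusLocal_add_le r hpos hp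
        · exact (abs_nonneg _).trans
            (abs_mulExt_le (fun _ _ _ _ => (abs_of_nonneg (by positivity)).le) d)
    · rw [abs_zero]
      exact mul_nonneg (by positivity) (mul_nonneg (hm0 n) (hm0 d))
  rw [e, abs_mul, abs_of_nonneg (by positivity : (0 : ℝ) ≤ 1 / Nat.totient h)]
  refine (mul_le_of_le_one_left (abs_nonneg _) ?_).trans ?_
  · exact div_le_one_of_le₀ hphi (by positivity)
  calc _ ≤ ∑ n ∈ Finset.Icc 1 ⌊U⌋₊, ∑ d ∈ Finset.Icc 1 ⌊R⌋₊,
        (2 * h + 1) * (majorant (4 + h : ℝ) n * majorant (4 + h) d) :=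
        (Finset.abs_sum_le_sum_abs _ _).trans (Finset.sum_le_sum fun n hn =>
          (Finset.abs_sum_le_sum_abs _ _).trans (Finset.sum_le_sum fun d hd => hbound n hn d hd))
    _ = (2 * h + 1) * ((∑ n ∈ Finset.Icc 1 ⌊U⌋₊, majorant (4 + h : ℝ) n) *
          ∑ d ∈ Finset.Icc 1 ⌊R⌋₊, majorant (4 + h : ℝ) d) := by
        rw [Finset.sum_mul_sum, Finset.mul_sum]
        exact Finset.sum_congr rfl fun n _ => by rw [Finset.mul_sum]
    _ ≤ (2 * h + 1) * M ^ 2 := by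
        rw [pow_two]
        have := hpart ⌊U⌋₊
        have := hpart ⌊R⌋₊
        have hM0 : 0 ≤ M := tsum_nonneg hm0
        gcongr
        exact Finset.sum_nonneg fun d _ => hm0 d

lemma card_roots_eq {p : ℕ} (hp : p.Prime) (hp2 : p ≠ 2) (r : ℤ) :
    ∑ v ∈ Finset.range p, (if (p : ℤ) ∣ (v : ℤ) ^ 2 - r then (1 : ℝ) else 0)
      = 1 + jacobiSym r p := by
  have := Fact.mk hp
  have h1 : ∀ v ∈ Finset.range p, (if (p : ℤ) ∣ (v : ℤ) ^ 2 - r then (1 : ℝ) else 0)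
      = (fun x : ZMod p => if x ^ 2 = r then (1 : ℝ) else 0) (v : ZMod p) := fun v _ => by
    refine if_congr ?_ rfl rfl
    rw [← ZMod.intCast_zmod_eq_zero_iff_dvd]
    push_cast
    exact sub_eq_zero
  rw [Finset.sum_congr rfl h1, sum_range_eq_sum_zmod p (fun x : ZMod p =>
    if x ^ 2 = r then (1 : ℝ) else 0), Finset.sum_boole]
  have h2 := legendreSym.card_sqrts p hp2 r
  rw [jacobiSym.legendreSym.to_jacobiSym] at h2
  have h3 : ({x : ZMod p | x ^ 2 = r}.toFinset) = Finset.univ.filter fun x : ZMod p => x ^ 2 = r := by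
    ext x
    simp
  rw [h3] at h2
  have h4 : ((Finset.univ.filter fun x : ZMod p => x ^ 2 = r).card : ℝ)
      = ((jacobiSym r p + 1 : ℤ) : ℝ) := by
    rw [← h2]
    simp
  rw [h4]
  push_cast
  ring

lemma unitCount_prime_pow {p k : ℕ} (hp : p.Prime) (hp2 : p ≠ 2) (hk : k ≠ 0) (r : ℤ) :
    unitCount r (p ^ k) = (p : ℝ) ^ (k - 1) * ((p : ℝ) - 1 - jacobiSym r p) := by
  have h0 : ∀ v : ℕ, (if Int.gcd ((v : ℤ) ^ 2 - r) ((p ^ k : ℕ) : ℤ) = 1 then (1 : ℝ) else 0)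
      = if Int.gcd ((v : ℤ) ^ 2 - r) (p : ℤ) = 1 then 1 else 0 := fun v => by
    refine if_congr ?_ rfl rfl
    rw [gcd_prime_pow_eq_one_iff hp hk]
    simpa using (gcd_prime_pow_eq_one_iff hp one_ne_zero ((v : ℤ) ^ 2 - r)).symm
  have hpk : p ^ k = p * p ^ (k - 1) := by rw [← pow_succ', Nat.sub_add_cancel (by omega)]
  simp only [unitCount, h0]
  rw [hpk, sum_range_mul_of_periodic
    (u := fun v => if Int.gcd ((v : ℤ) ^ 2 - r) (p : ℤ) = 1 then (1 : ℝ) else 0)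
    (fun a => by rw [gcd_sq_sub_mod])]
  push_cast
  congr 1
  have h1 : ∀ v ∈ Finset.range p, (if Int.gcd ((v : ℤ) ^ 2 - r) (p : ℤ) = 1 then (1 : ℝ) else 0)
      = 1 - if (p : ℤ) ∣ (v : ℤ) ^ 2 - r then 1 else 0 := fun v _ => by
    have := gcd_prime_pow_eq_one_iff hp one_ne_zero ((v : ℤ) ^ 2 - r)
    rw [pow_one] at this
    simp only [this]
    split_ifs <;> simp
  rw [Finset.sum_congr rfl h1, Finset.sum_sub_distrib, card_roots_eq hp hp2]
  simp
  ring

lemma unitCount_mul (r : ℤ) {m n : ℕ} (hmn : Nat.Coprime m n) :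
    unitCount r (m * n) = unitCount r m * unitCount r n := by
  rcases Nat.eq_zero_or_pos m with rfl | hm
  · simp [unitCount]
  rcases Nat.eq_zero_or_pos n with rfl | hn
  · simp [unitCount]
  simp only [unitCount]
  rw [← sum_range_mul_of_coprime hm hn hmn
    (u := fun v => if Int.gcd ((v : ℤ) ^ 2 - r) (m : ℤ) = 1 then (1 : ℝ) else 0)
    (v := fun v => if Int.gcd ((v : ℤ) ^ 2 - r) (n : ℤ) = 1 then (1 : ℝ) else 0)
    (fun a => by rw [gcd_sq_sub_mod]) (fun a => by rw [gcd_sq_sub_mod])]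
  refine Finset.sum_congr rfl fun a _ => ?_
  have h1 : Int.gcd ((a : ℤ) ^ 2 - r) ((m * n : ℕ) : ℤ) = 1
      ↔ Int.gcd ((a : ℤ) ^ 2 - r) (m : ℤ) = 1 ∧ Int.gcd ((a : ℤ) ^ 2 - r) (n : ℤ) = 1 := by
    simp only [← Int.isCoprime_iff_gcd_eq_one]
    push_cast
    exact IsCoprime.mul_right_iff
  rw [if_congr h1 rfl rfl, ite_and, ite_mul, one_mul, zero_mul]

lemma unitCount_div_totient (r : ℤ) {h : ℕ} (hodd : Odd h) :
    unitCount r h / Nat.totient h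
      = ∏ p ∈ h.primeFactors, ((p : ℝ) - 1 - jacobiSym r p) / ((p : ℝ) - 1) := by
  have e := eq_mulExt (fun n => unitCount r n / Nat.totient n)
    (fun m n hmn => by
      rw [unitCount_mul r hmn, Nat.totient_mul hmn]
      push_cast
      rw [div_mul_div_comm]) (by simp [unitCount])
    (fun p _ => ((p : ℝ) - 1 - jacobiSym r p) / ((p : ℝ) - 1)) hodd.pos.ne' ?_
  · rw [← mulExt_of_ne_zero (fun p _ => ((p : ℝ) - 1 - jacobiSym r p) / ((p : ℝ) - 1)) hodd.pos.ne',
      ← e]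
  · intro p hph k hk
    have hp := Nat.prime_of_mem_primeFactors hph
    have hp2 : p ≠ 2 := by
      rintro rfl
      exact (Nat.not_even_iff_odd.mpr hodd)
        (even_iff_two_dvd.mpr (Nat.dvd_of_mem_primeFactors hph))
    have hp0 : (p : ℝ) ≠ 0 := by exact_mod_cast hp.ne_zero
    rw [unitCount_prime_pow hp hp2 hk, Nat.totient_prime_pow hp (Nat.pos_of_ne_zero hk)]
    push_cast [hp.one_le]
    rw [mul_div_mul_left _ _ (pow_ne_zero _ hp0)]

lemma one_add_tsum_charMean_of_dvd (r : ℤ) {h p : ℕ} (hp : p.Prime) (hp2 : p ≠ 2) (hph : p ∣ h) :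
    1 + ∑' k : ℕ, charMean r h p (k + 1) = p / ((p : ℝ) - jacobiSym r p) := by
  have hp0 : (1 : ℝ) < p := by exact_mod_cast hp.one_lt
  have hJ := abs_jacobiSym_le_one r p
  set J : ℝ := (jacobiSym r p : ℝ) with hJdef
  have hlt : |J / p| < 1 := by
    rw [abs_div, Nat.abs_cast, div_lt_one (by linarith)]
    linarith
  have h1 : ∀ k : ℕ, charMean r h p (k + 1) = J / p * (J / p) ^ k := fun k => by
    simp [charMean, charLocal, charLocalDiv, hp2, hph, Dvd.dvd.mul_left, ← hJdef]
    rw [← div_pow, pow_succ']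
  simp only [h1]
  rw [tsum_mul_left, tsum_geometric_of_abs_lt_one hlt]
  have h2 : (p : ℝ) - J ≠ 0 := by
    have := (abs_le.mp hJ).2
    linarith
  have h3 : 1 - J / p ≠ 0 := by
    have := (abs_lt.mp hlt).2
    linarith
  field_simp
  ring

lemma one_add_tsum_charMean_of_not_dvd (r : ℤ) {h p : ℕ} (hp : p.Prime) (hp2 : p ≠ 2)
    (hph : ¬ p ∣ h) :
    1 + ∑' k : ℕ, charMean r h p (k + 1) = 1 - 1 / ((p : ℝ) * ((p : ℝ) ^ 2 - 1)) := by
  have hp1 : (1 : ℝ) < p := by exact_mod_cast hp.one_lt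
  have z0 : (p : ℝ) ≠ 0 := by linarith
  have z1 : (p : ℝ) - 1 ≠ 0 := by linarith
  have z2 : (p : ℝ) + 1 ≠ 0 := by linarith
  have z3 : (p : ℝ) ^ 2 - 1 ≠ 0 := by nlinarith
  have hlt : |1 / (p : ℝ)| < 1 := by
    rw [abs_div, abs_one, Nat.abs_cast, div_lt_one (by linarith)]
    exact hp1
  have hlt' : |-(1 / (p : ℝ))| < 1 := by rwa [abs_neg]
  have h1 : ∀ k : ℕ, charMean r h p (k + 1) = ((p : ℝ) - 2) / (2 * p ^ 2) * (1 / (p : ℝ)) ^ k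
      - 1 / (2 * p) * (-(1 / (p : ℝ))) ^ k := fun k => by
    simp only [charMean, charLocal, charLocalDiv, hp2, hph, prime_dvd_two_mul_iff hp hp2, if_false]
    rcases Nat.even_or_odd k with hk | hk
    · rw [if_neg (by simpa [Nat.even_add_one] using hk), hk.neg_pow, one_div_pow]
      field_simp
      ring
    · rw [if_pos (by simpa [Nat.even_add_one] using hk), hk.neg_pow, one_div_pow]
      field_simp
      ring
  simp only [h1]
  rw [((summable_geometric_of_abs_lt_one hlt).mul_left _).tsum_sub
    ((summable_geometric_of_abs_lt_one hlt').mul_left _), tsum_mul_left, tsum_mul_left,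
    tsum_geometric_of_abs_lt_one hlt, tsum_geometric_of_abs_lt_one hlt']
  have e1 : (1 - 1 / (p : ℝ))⁻¹ = p / ((p : ℝ) - 1) := by
    rw [one_sub_div z0, inv_div]
  have e2 : (1 - -(1 / (p : ℝ)))⁻¹ = p / ((p : ℝ) + 1) := by
    rw [sub_neg_eq_add, one_add_div z0, inv_div]
  rw [e1, e2]
  field_simp
  ring

lemma hasProd_locC (r : ℤ) {h : ℕ} (hpos : 0 < h) (hodd : Odd h) :
    HasProd (locC r h) ((∑' n, mulExt (charMean r h) n * coprimeSum (moebiusMean r h) n) *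
      (unitCount r h / Nat.totient h)) := by
  have h1 := hasProd_coprime_pairs (a := charMean r h) (b := moebiusMean r h) (c := 4 + h)
    (by positivity) (fun p k hp hk => abs_charMean_le r hpos hp hk)
    (fun p k hp _ => abs_moebiusMean_le r hpos hp)
    (fun p k hk => moebiusMean_of_ne_one r h p (by omega))
    (fun p hp => half_le_one_add_moebiusMean r hp)
  set F : ℕ → ℝ := fun p =>
    if p ∈ h.primeFactors then ((p : ℝ) - 1 - jacobiSym r p) / ((p : ℝ) - 1) else 1 with hF
  have h2 : HasProd F (unitCount r h / Nat.totient h) := by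
    have := hasProd_prod_of_ne_finset_one (f := F) (s := h.primeFactors) (L := .unconditional ℕ)
      (fun p hp => if_neg hp)
    rw [unitCount_div_totient r hodd]
    rwa [Finset.prod_congr rfl fun p hp => (if_pos hp : F p = _)] at this
  refine (congrArg (fun G : ℕ → ℝ => HasProd G _) ?_).mpr (h1.mul h2)
  funext p
  by_cases hp : p.Prime
  swap
  · simp [locC, hF, hp]
  by_cases hp2 : p = 2
  · subst hp2
    have h2h : ¬ 2 ∣ h := fun hd => (Nat.not_even_iff_odd.mpr hodd) (even_iff_two_dvd.mpr hd)
    simp [locC, hF, h2h, Nat.prime_two, moebiusMean_two, charMean, charLocal, charLocalDiv]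
  have hp1 : (1 : ℝ) < p := by exact_mod_cast hp.one_lt
  have z0 : (p : ℝ) ≠ 0 := by linarith
  have z1 : (p : ℝ) - 1 ≠ 0 := by linarith
  have hmem : p ∈ h.primeFactors ↔ p ∣ h := by simp [hp, hpos.ne']
  simp only [locC, hF, hp, hp2, ne_eq, not_false_eq_true, and_self, if_true, hmem]
  by_cases hph : p ∣ h
  · rw [if_pos hph, if_pos hph, add_right_comm, add_assoc, add_comm (moebiusMean _ _ _ _),
      ← add_assoc, one_add_tsum_charMean_of_dvd r hp hp2 hph, moebiusMean_one_of_dvd r hp2 hph]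
    by_cases hpr : (p : ℤ) ∣ r
    · have hJ : jacobiSym r p = 0 := by
        have := jacobiSym_sq_prime hp r
        rw [if_pos hpr] at this
        exact pow_eq_zero_iff two_ne_zero |>.mp this
      rw [hJ]
      by_cases hp2h : p ^ 2 ∣ h
      · simp [hpr, hp2h, z0, z1]
      · simp [hpr, hp2h, z0, z1]
        field_simp
        ring
    · rw [if_neg hpr, if_neg (fun h => hpr h.1), add_zero, div_mul_div_comm,
        mul_comm ((p : ℝ) - jacobiSym r p)]
  · rw [if_neg hph, if_neg hph, mul_one, one_add_tsum_charMean_of_not_dvd r hp hp2 hph,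
      moebiusMean_one_of_not_dvd r hp hp2 hph]
    have z3 : (p : ℝ) ^ 2 - 1 ≠ 0 := by nlinarith
    field_simp
    ring

lemma three_halves_mul_frakC (r : ℤ) {h : ℕ} (hpos : 0 < h) (hodd : Odd h) :
    3 / 2 * frakC r h = unitCount r h / (2 * h * Nat.totient h) *
      ∑' n, mulExt (charMean r h) n * coprimeSum (moebiusMean r h) n := by
  rw [frakC, (hasProd_locC r hpos hodd).tprod_eq]
  have h1 : (h : ℝ) ≠ 0 := by exact_mod_cast hpos.ne'
  have h2 : (Nat.totient h : ℝ) ≠ 0 := by exact_mod_cast (Nat.totient_pos.mpr hpos).ne'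
  field_simp

lemma unitCount_nonneg (r : ℤ) (h : ℕ) : 0 ≤ unitCount r h :=
  Finset.sum_nonneg fun v _ => by split_ifs <;> simp

/-- `S(T) = (3/2)·𝔠(r,h)·T + O(T·log R/R + T·U^{ε-1/2} + 1)`. -/
theorem stmt5 (h : ℕ) (hpos : 0 < h) (hodd : Odd h) (r : ℤ)
    (hsf : Squarefree (Int.gcd r (h : ℤ))) (ε : ℝ) (hε : 0 < ε) :
    ∃ C : ℝ, ∀ T U R : ℝ, 2 ≤ T → 2 ≤ U → 2 ≤ R →
      |Ssum r h T U R - 3 / 2 * frakC r h * T| ≤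
        C * (T * Real.log R / R + T * U ^ (ε - 1 / 2) + 1) := by
  set s : ℝ := max 0 (1 / 2 - ε) with hs
  have hs0 : 0 ≤ s := le_max_left _ _
  have hs2 : s < 1 / 2 := max_lt (by norm_num) (by linarith)
  have hc : (0 : ℝ) ≤ 4 + h := by positivity
  set M := ∑' n, majorant (4 + h : ℝ) n with hM
  set W := ∑' n : ℕ, majorant (4 + h : ℝ) n * (n : ℝ) ^ s with hW
  set κ := unitCount r h / (2 * h * Nat.totient h) with hκ
  have hM0 : 0 ≤ M := tsum_nonneg (majorant_nonneg hc)
  have hW0 : 0 ≤ W := tsum_nonneg fun n => mul_nonneg (majorant_nonneg hc n) (by positivity)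
  have hκ0 : 0 ≤ κ := div_nonneg (unitCount_nonneg r h) (by positivity)
  have hl2 : 0 < Real.log 2 := Real.log_pos one_lt_two
  refine ⟨(2 * h + 1) * M ^ 2 + κ * (M * h * (2 / Real.log 2)) + κ * (M * W),
    fun T U R hT hU hR => ?_⟩
  have hR0 : 0 < R := by linarith
  have hT0 : 0 ≤ T := by linarith
  have h1 := abs_Ssum_sub_le hpos hodd hsf hT0 U R
  have h2 := abs_coprime_truncation_le (a := charMean r h) (b := moebiusMean r h) hc
    (Nat.cast_nonneg h) (fun p k hp hk => abs_charMean_le r hpos hp hk)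
    (fun p k hp _ => abs_moebiusMean_le r hpos hp) (abs_mulExt_moebiusMean_le r hpos)
    hs0 hs2 hU hR
  rw [three_halves_mul_frakC r hpos hodd]
  rw [← hκ] at h1 ⊢
  rw [← hM] at h1 h2
  rw [← hW] at h2
  set P := ∑ n ∈ Finset.Icc 1 ⌊U⌋₊, ∑ d ∈ Finset.Icc 1 ⌊R⌋₊,
    if Nat.Coprime n d then mulExt (charMean r h) n * mulExt (moebiusMean r h) d else 0 with hP
  set Q := ∑' n, mulExt (charMean r h) n * coprimeSum (moebiusMean r h) n with hQ
  have hlog : 2 / R ≤ 2 / Real.log 2 * (Real.log R / R) := by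
    rw [div_mul_div_comm, div_le_div_iff₀ hR0 (by positivity)]
    have := Real.log_le_log two_pos hR
    nlinarith
  have hpow : U ^ (-s) ≤ U ^ (ε - 1 / 2) := by
    refine Real.rpow_le_rpow_of_exponent_le (by linarith) ?_
    have := le_max_right 0 (1 / 2 - ε)
    linarith
  have hx : 0 ≤ T * Real.log R / R := by
    have := Real.log_nonneg (show (1 : ℝ) ≤ R by linarith)
    positivity
  have hy : 0 ≤ T * U ^ (ε - 1 / 2) := by positivity
  have h3 : |T * κ * P - T * κ * Q| ≤ κ * (M * h * (2 / Real.log 2)) * (T * Real.log R / R)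
      + κ * (M * W) * (T * U ^ (ε - 1 / 2)) := by
    rw [← mul_sub, abs_mul, abs_of_nonneg (mul_nonneg hT0 hκ0)]
    calc T * κ * |P - Q| ≤ T * κ * (M * (h * (2 / R)) + M * (U ^ (-s) * W)) := by gcongr
      _ ≤ T * κ * (M * (h * (2 / Real.log 2 * (Real.log R / R)))
          + M * (U ^ (ε - 1 / 2) * W)) := by gcongr
      _ = _ := by ring
  have h4 : |Ssum r h T U R - T * κ * Q| ≤ (2 * h + 1) * M ^ 2 +
      (κ * (M * h * (2 / Real.log 2)) * (T * Real.log R / R)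
      + κ * (M * W) * (T * U ^ (ε - 1 / 2))) :=
    (abs_sub_le _ (T * κ * P) _).trans (add_le_add h1 h3)
  have hA : 0 ≤ (2 * h + 1) * M ^ 2 := by positivity
  have hB : 0 ≤ κ * (M * h * (2 / Real.log 2)) := by positivity
  have hD : 0 ≤ κ * (M * W) := by positivity
  rw [show κ * Q * T = T * κ * Q by ring]
  refine h4.trans ?_
  nlinarith [mul_nonneg hA hx, mul_nonneg hA hy, mul_nonneg hB hy, mul_nonneg hD hx]
end
end

section
/- Let ℓ be an odd prime, r an integer with ℓ ∤ r, α ≥ 1 an integer, and β = max(α, 2). Then #{ g ∈ GL₂(ℤ/ℓ^βℤ) : tr(g)² − 4·det(g) ≢ 0 (mod ℓ²) and tr(g)² − 4·det(g) ≡ r (mod ℓ^α) } / #GL₂(ℤ/ℓ^βℤ) = ℓ·(ℓ−1−(r|ℓ)) / ( (ℓ−1)·(ℓ−(r|ℓ))·ℓ^α ), where (r|ℓ) is the Legendre symbol. -/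
/-- The discriminant `tr(g)² - 4 det(g)` of a matrix in `GL₂(ℤ/mℤ)`. -/
def glDisc (m : ℕ) (g : Matrix.GeneralLinearGroup (Fin 2) (ZMod m)) : ZMod m :=
  (Matrix.trace (g : Matrix (Fin 2) (Fin 2) (ZMod m))) ^ 2 -
    4 * Matrix.det (g : Matrix (Fin 2) (Fin 2) (ZMod m))

open Finset in
theorem AddMonoidHom.card_filter_comp_mul_card {A B : Type*} [AddGroup A] [AddGroup B]
    [Fintype A] [Fintype B] [DecidableEq B] (φ : A →+ B) (hφ : Function.Surjective φ)
    (P : B → Prop) [DecidablePred P] :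
    #{a | P (φ a)} * Fintype.card B = #{b | P b} * Fintype.card A := by
  have hfib : ∀ b, #{a | φ a = b} = #{a | φ a = 0} := fun b =>
    AddMonoidHom.card_fiber_eq_of_mem_range φ (hφ b) (hφ 0)
  have hcard : Fintype.card A = Fintype.card B * #{a | φ a = 0} := by
    rw [← card_univ, card_eq_sum_card_fiberwise (f := φ) (t := univ) (by simp)]
    simp [hfib]
  have hP : #{a | P (φ a)} = #{b | P b} * #{a | φ a = 0} := by
    rw [card_eq_sum_card_fiberwise (f := φ) (t := {b | P b}) (by intro; simp),
      sum_const_nat]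
    intro b hb
    rw [← hfib b, filter_filter]
    congr 1
    ext a
    simp only [mem_filter, mem_univ, true_and] at hb ⊢
    exact ⟨fun h => h.2, fun h => ⟨h ▸ hb, h⟩⟩
  rw [hP, hcard]
  ring

theorem Matrix.card_GL_subtype {n S : Type*} [Fintype n] [DecidableEq n] [CommRing S]
    (P : Matrix n n S → Prop) :
    Nat.card {g : Matrix.GeneralLinearGroup n S // P g} =
      Nat.card {A : Matrix n n S // IsUnit A.det ∧ P A} := by
  refine Nat.card_congr (Equiv.ofBijective
    (fun g => ⟨g.1, (Matrix.isUnit_iff_isUnit_det _).mp g.1.isUnit, g.2⟩) ⟨?_, ?_⟩)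
  · intro g h hgh
    exact Subtype.ext (Units.ext (congrArg Subtype.val hgh))
  · rintro ⟨A, hA, hP⟩
    obtain ⟨u, rfl⟩ := (Matrix.isUnit_iff_isUnit_det A).mpr hA
    exact ⟨⟨u, hP⟩, rfl⟩

theorem Matrix.card_GL_eq_card_isUnit_det {n S : Type*} [Fintype n] [DecidableEq n]
    [CommRing S] :
    Nat.card (Matrix.GeneralLinearGroup n S) = Nat.card {A : Matrix n n S // IsUnit A.det} := by
  simpa using (Nat.card_congr (Equiv.subtypeUnivEquiv (fun _ => trivial)).symm).trans
    (Matrix.card_GL_subtype (n := n) (S := S) fun _ => True)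

section LocalCounting

open Finset

variable {R K : Type*} [CommRing R] [Fintype R] [Field K] [Fintype K]
  [DecidableEq K] (f : R →+* K)

theorem RingHom.card_fiber_mul_card (hf : Function.Surjective f) (k : K) :
    #{x | f x = k} * Fintype.card K = Fintype.card R := by
  have h := f.toAddMonoidHom.card_filter_comp_mul_card hf (· = k)
  simpa [Finset.filter_eq'] using h

theorem RingHom.card_fiber_eq (hf : Function.Surjective f) (k k' : K) :
    #{x | f x = k} = #{x | f x = k'} :=
  Nat.eq_of_mul_eq_mul_right Fintype.card_pos
    ((f.card_fiber_mul_card hf k).trans (f.card_fiber_mul_card hf k').symm)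

theorem card_sqrts_eq_card_sqrts_map [DecidableEq R] [IsLocalHom f] (hf : Function.Surjective f)
    (hK : (2 : K) ≠ 0) {ρ : R} (hρ : f ρ ≠ 0) :
    #{u | u ^ 2 = ρ} = #{y | y ^ 2 = f ρ} := by
  have hinj : ∀ u v : R, f u = f v → f u ≠ 0 → u ^ 2 = v ^ 2 → u = v := by
    intro u v huv hu h
    have hunit : IsUnit (u + v) := by
      refine isUnit_of_map_unit f _ (isUnit_iff_ne_zero.mpr ?_)
      rw [map_add, ← huv, ← two_mul]
      exact mul_ne_zero hK hu
    refine sub_eq_zero.mp (hunit.mul_right_eq_zero.mp ?_)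
    linear_combination h
  have hne : ∀ y : K, y ^ 2 = f ρ → y ≠ 0 := by
    rintro y hy rfl
    exact hρ (by rw [← hy]; simp)
  refine card_bij (fun u _ => f u) ?_ ?_ ?_
  · intro u hu
    simp only [mem_filter, mem_univ, true_and] at hu ⊢
    rw [← map_pow, hu]
  · intro u hu v hv h
    simp only [mem_filter, mem_univ, true_and] at hu hv
    exact hinj u v h (hne _ (by rw [← map_pow, hu])) (hu.trans hv.symm)
  · intro y hy
    simp only [mem_filter, mem_univ, true_and] at hy
    have hsurj := surjOn_of_injOn_of_card_le (s := {u : R | f u = y})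
      (t := {x : R | f x = f ρ}) (fun u => u ^ 2)
      (by intro u hu; simp at hu ⊢; rw [hu, hy])
      (by
        intro u hu v hv h
        simp only [coe_filter, mem_univ, true_and, Set.mem_ofPred_eq] at hu hv
        exact hinj u v (hu.trans hv.symm) (hu ▸ hne y hy) h)
      (f.card_fiber_eq hf _ _).le
    obtain ⟨u, hu, huρ⟩ := hsurj (show ρ ∈ _ by simp)
    simp only [coe_filter, mem_univ, true_and, Set.mem_ofPred_eq] at hu
    exact ⟨u, by simpa using huρ, hu⟩

theorem card_sqrts_eq_quadraticChar_add_one [DecidableEq R] [IsLocalHom f]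
    (hf : Function.Surjective f) (hK : (2 : K) ≠ 0) {ρ : R} (hρ : f ρ ≠ 0) :
    (#{u | u ^ 2 = ρ} : ℤ) = quadraticChar K (f ρ) + 1 := by
  rw [card_sqrts_eq_card_sqrts_map f hf hK hρ, ← quadraticChar_card_sqrts]
  · simp
  · intro h
    have := ringChar.Nat.cast_ringChar (R := K)
    rw [h] at this
    exact hK (by exact_mod_cast this)

/-- The number of solutions of `u² + 4bc = ρ`, where `f` is the residue map of `R`. -/
theorem card_sq_add_four_mul_eq [DecidableEq R] [IsLocalHom f] (hf : Function.Surjective f)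
    (hK : (2 : K) ≠ 0) {ρ : R} (hρ : f ρ ≠ 0) :
    (#{x : R × R × R | x.1 ^ 2 + 4 * (x.2.1 * x.2.2) = ρ} : ℤ) =
      Fintype.card R * #{x | f x = 0} * (Fintype.card K + quadraticChar K (f ρ)) := by
  have hsum : #{x : R × R × R | x.1 ^ 2 + 4 * (x.2.1 * x.2.2) = ρ} =
      ∑ b, ∑ c, #{u : R | u ^ 2 + 4 * (b * c) = ρ} := by
    simp only [card_filter, Fintype.sum_prod_type]
    rw [sum_comm]
    exact sum_congr rfl fun b _ => sum_comm
  have hunit : ∀ b, f b ≠ 0 →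
      ∑ c, (#{u : R | u ^ 2 + 4 * (b * c) = ρ} : ℤ) = Fintype.card R := by
    intro b hb
    have h4 : IsUnit (4 * b) := by
      refine isUnit_of_map_unit f _ (isUnit_iff_ne_zero.mpr ?_)
      have : f (4 * b) = 2 * 2 * f b := by
        rw [map_mul, map_ofNat]
        ring
      rw [this]
      exact mul_ne_zero (mul_ne_zero hK hK) hb
    obtain ⟨w, hw⟩ := h4.exists_left_inv
    have : ∀ u, #{c : R | u ^ 2 + 4 * (b * c) = ρ} = 1 := by
      intro u
      rw [card_eq_one]
      refine ⟨w * (ρ - u ^ 2), ?_⟩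
      ext c
      simp only [mem_filter, mem_univ, true_and, mem_singleton]
      constructor
      · rintro rfl
        linear_combination -c * hw
      · rintro rfl
        linear_combination (ρ - u ^ 2) * hw
    have h : ∑ c, #{u : R | u ^ 2 + 4 * (b * c) = ρ} =
        ∑ u, #{c : R | u ^ 2 + 4 * (b * c) = ρ} := by
      simp only [card_filter]
      exact sum_comm
    rw [← Nat.cast_sum, h]
    simp [this]
  have hnonunit : ∀ b, f b = 0 → ∑ c, (#{u : R | u ^ 2 + 4 * (b * c) = ρ} : ℤ) =
      Fintype.card R * (quadraticChar K (f ρ) + 1) := by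
    intro b hb
    have : ∀ c, (#{u : R | u ^ 2 + 4 * (b * c) = ρ} : ℤ) = quadraticChar K (f ρ) + 1 := by
      intro c
      have hmap : f (ρ - 4 * (b * c)) = f ρ := by simp [hb]
      rw [← hmap, ← card_sqrts_eq_quadraticChar_add_one f hf hK (hmap ▸ hρ)]
      simp only [eq_sub_iff_add_eq]
    simp [this]
  have hcard : (#{b | f b ≠ 0} : ℤ) = #{b | f b = 0} * (Fintype.card K - 1) := by
    have h1 := card_filter_add_card_filter_not (s := (univ : Finset R)) (fun b => f b = 0)
    have h2 := f.card_fiber_mul_card hf 0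
    rw [card_univ, ← h2] at h1
    zify at h1
    linear_combination h1
  rw [hsum]
  push_cast
  rw [← sum_filter_add_sum_filter_not univ (fun b => f b = 0),
    sum_congr rfl fun b hb => hnonunit b (by simpa using hb),
    sum_congr (s₂ := {b | f b ≠ 0}) rfl fun b hb => hunit b (by simpa using hb)]
  simp only [sum_const, nsmul_eq_mul]
  rw [hcard]
  ring

theorem card_sq_ne (hf : Function.Surjective f) (hK : (2 : K) ≠ 0) (k : K) :
    (#{t : R | f t ^ 2 ≠ k} : ℤ) =
      #{x | f x = 0} * (Fintype.card K - 1 - quadraticChar K k) := by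
  have hchar : ringChar K ≠ 2 := by
    intro h
    have := ringChar.Nat.cast_ringChar (R := K)
    rw [h] at this
    exact hK (by exact_mod_cast this)
  have h1 := f.toAddMonoidHom.card_filter_comp_mul_card hf (fun y => y ^ 2 ≠ k)
  have h2 := quadraticChar_card_sqrts hchar k
  have h3 := card_filter_add_card_filter_not (s := (univ : Finset K)) (fun y => y ^ 2 = k)
  have h4 := f.card_fiber_mul_card hf 0
  have h5 : ((Fintype.card K : ℕ) : ℤ) ≠ 0 := by exact_mod_cast Fintype.card_ne_zero
  simp only [Set.toFinset_ofPred] at h2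
  rw [card_univ] at h3
  rw [← h4] at h1
  change #{t : R | f t ^ 2 ≠ k} * _ = _ at h1
  zify at h1 h3
  refine mul_right_cancel₀ h5 ?_
  rw [h1]
  linear_combination (#{x | f x = 0} * Fintype.card K : ℤ) * (h3 - h2)

/-- The number of invertible `2 × 2` matrices over `R` whose discriminant lies in a set of elements
with a common nonzero residue `k`. -/
theorem card_isUnit_det_and_disc [IsLocalHom f] (hf : Function.Surjective f)
    (hK : (2 : K) ≠ 0) {k : K} (hk : k ≠ 0) (Q : R → Prop) [DecidablePred Q]
    (hQ : ∀ ρ, Q ρ → f ρ = k) :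
    (Nat.card {A : Matrix (Fin 2) (Fin 2) R //
        IsUnit A.det ∧ Q (A.trace ^ 2 - 4 * A.det)} : ℤ) =
      (#{x | f x = 0} * (Fintype.card K - 1 - quadraticChar K k)) *
        (#{ρ | Q ρ} * (Fintype.card R * #{x | f x = 0} *
          (Fintype.card K + quadraticChar K k))) := by
  classical
  have h2 : IsUnit (2 : R) :=
    isUnit_of_map_unit f _ (isUnit_iff_ne_zero.mpr (by rwa [map_ofNat]))
  obtain ⟨w, hw⟩ := h2.exists_left_inv
  let e : Matrix (Fin 2) (Fin 2) R ≃ R × R × R × R :=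
    { toFun := fun A => (A 0 0 + A 1 1, A 0 0 - A 1 1, A 0 1, A 1 0)
      invFun := fun x => !![w * (x.1 + x.2.1), x.2.2.1; x.2.2.2, w * (x.1 - x.2.1)]
      left_inv := by
        intro A
        ext i j
        fin_cases i <;> fin_cases j <;> simp
        · linear_combination A 0 0 * hw
        · linear_combination A 1 1 * hw
      right_inv := by
        rintro ⟨t, u, b, c⟩
        simp only [Matrix.of_apply, Matrix.cons_val', Matrix.cons_val_zero, Matrix.cons_val_one,
          Matrix.cons_val_fin_one, Prod.mk.injEq, and_true]
        exact ⟨by linear_combination t * hw, by linear_combination u * hw⟩ }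
  have hcond : ∀ A : Matrix (Fin 2) (Fin 2) R,
      (IsUnit A.det ∧ Q (A.trace ^ 2 - 4 * A.det)) ↔
        (f (e A).1 ^ 2 ≠ k ∧ Q ((e A).2.1 ^ 2 + 4 * ((e A).2.2.1 * (e A).2.2.2))) := by
    intro A
    have hdisc : (e A).2.1 ^ 2 + 4 * ((e A).2.2.1 * (e A).2.2.2) =
        A.trace ^ 2 - 4 * A.det := by
      rw [Matrix.trace_fin_two, Matrix.det_fin_two]
      simp only [e, Equiv.coe_fn_mk]
      ring
    rw [hdisc]
    refine and_congr_left fun h => ?_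
    have hfk := hQ _ h
    rw [map_sub, map_mul, map_pow, map_ofNat] at hfk
    have htr : (e A).1 = A.trace := by
      rw [Matrix.trace_fin_two]
      rfl
    have h4 : (4 : K) ≠ 0 := by
      have : (4 : K) = 2 * 2 := by norm_num
      rw [this]
      exact mul_ne_zero hK hK
    rw [htr, ← isUnit_map_iff f, isUnit_iff_ne_zero, ← hfk]
    rw [ne_eq, ne_eq, eq_sub_iff_add_eq, add_eq_left, mul_eq_zero, or_iff_right h4]
  have hcount : Nat.card {A : Matrix (Fin 2) (Fin 2) R //
      IsUnit A.det ∧ Q (A.trace ^ 2 - 4 * A.det)} =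
      #{t : R | f t ^ 2 ≠ k} * #{x : R × R × R | Q (x.1 ^ 2 + 4 * (x.2.1 * x.2.2))} := by
    rw [Nat.card_congr (e.subtypeEquiv (q := fun x => f x.1 ^ 2 ≠ k ∧
      Q (x.2.1 ^ 2 + 4 * (x.2.2.1 * x.2.2.2))) hcond), Nat.card_eq_fintype_card,
      Fintype.card_subtype, ← card_product]
    congr 1
    ext x
    simp
  have hfib : (#{x : R × R × R | Q (x.1 ^ 2 + 4 * (x.2.1 * x.2.2))} : ℤ) =
      #{ρ | Q ρ} * (Fintype.card R * #{x | f x = 0} *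
        (Fintype.card K + quadraticChar K k)) := by
    rw [card_eq_sum_card_fiberwise (f := fun x : R × R × R => x.1 ^ 2 + 4 * (x.2.1 * x.2.2))
      (t := {ρ | Q ρ}) (by intro; simp), Nat.cast_sum, ← nsmul_eq_mul, ← sum_const]
    refine sum_congr rfl fun ρ hρ => ?_
    simp only [mem_filter, mem_univ, true_and] at hρ
    rw [← hQ ρ hρ, ← card_sq_add_four_mul_eq f hf hK (by rwa [hQ ρ hρ]), filter_filter]
    congr 2
    ext x
    simp only [mem_filter, mem_univ, true_and]
    exact ⟨fun h => h.2, fun h => ⟨h ▸ hρ, h⟩⟩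
  rw [hcount, Nat.cast_mul, hfib, card_sq_ne f hf hK]

theorem card_GL_fin_two_mul [IsLocalHom f] (hf : Function.Surjective f) :
    Nat.card (Matrix.GeneralLinearGroup (Fin 2) R) * Fintype.card K ^ 4 =
      Nat.card (Matrix.GeneralLinearGroup (Fin 2) K) * Fintype.card R ^ 4 := by
  classical
  have hsurj : Function.Surjective
      f.mapMatrix.toAddMonoidHom (α := Matrix (Fin 2) (Fin 2) R) := by
    intro B
    choose g hg using hf
    exact ⟨B.map g, by ext i j; simp [hg]⟩
  have h := AddMonoidHom.card_filter_comp_mul_card _ hsurj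
    (fun B : Matrix (Fin 2) (Fin 2) K => IsUnit B.det)
  have hdet : ∀ A : Matrix (Fin 2) (Fin 2) R, IsUnit (f.mapMatrix A).det ↔ IsUnit A.det := by
    intro A
    rw [← RingHom.map_det, isUnit_map_iff]
  change #{A : Matrix (Fin 2) (Fin 2) R | IsUnit (f.mapMatrix A).det} * _ = _ at h
  simp only [hdet, ← Fintype.card_subtype] at h
  simp only [← Nat.card_eq_fintype_card] at h ⊢
  have hpow : ∀ m : ℕ, (m ^ 2) ^ 2 = m ^ 4 := fun m => (pow_mul m 2 2).symm
  simpa only [Matrix, Nat.card_fun, Nat.card_fin, hpow, Matrix.card_GL_eq_card_isUnit_det]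
    using h

end LocalCounting

theorem ZMod.isLocalHom_castHom_prime_pow {p n : ℕ} (hp : p.Prime) (h : p ∣ p ^ n) :
    IsLocalHom (ZMod.castHom h (ZMod p)) := by
  have : NeZero (p ^ n) := ⟨pow_ne_zero _ hp.ne_zero⟩
  refine ⟨fun x hx => ?_⟩
  obtain ⟨m, rfl⟩ := ZMod.natCast_zmod_surjective x
  rw [map_natCast, ZMod.isUnit_iff_coprime] at hx
  exact (ZMod.isUnit_iff_coprime _ _).mpr (hx.pow_right n)

theorem ZMod.castHom_eq_intCast_iff {m n : ℕ} [NeZero n] (h : m ∣ n) (x : ZMod n) (r : ℤ) :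
    ZMod.castHom h (ZMod m) x = r ↔ (x.val : ℤ) ≡ r [ZMOD m] := by
  rw [← ZMod.intCast_eq_intCast_iff]
  conv_lhs => rw [← ZMod.natCast_zmod_val x, map_natCast]
  rw [Int.cast_natCast]

theorem count_div_card_GL_eq {q M c N G a χ : ℝ} (hq : 1 < q) (hN : 0 < N) (ha : 0 < a)
    (hM : M * q = N) (hc : c * a = N)
    (hG : G * q ^ 4 = (q ^ 2 - 1) * (q ^ 2 - q) * N ^ 4) (hχ : χ = 1 ∨ χ = -1) :
    M * (q - 1 - χ) * (c * (N * M * (q + χ))) / G =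
      q * (q - 1 - χ) / ((q - 1) * (q - χ) * a) := by
  subst hM
  have hq0 : q ≠ 0 := by positivity
  have hq1 : q - 1 ≠ 0 := by linarith
  have hq2 : q + 1 ≠ 0 := by linarith
  have hM0 : M ≠ 0 := left_ne_zero_of_mul hN.ne'
  have hGM : G = (q - 1) ^ 2 * (q + 1) * q * M ^ 4 := by
    refine mul_right_cancel₀ (pow_ne_zero 4 hq0) ?_
    rw [hG]
    ring
  have hcM : c = M * q / a := (eq_div_iff ha.ne').mpr hc
  subst hGM hcM
  rcases hχ with rfl | rfl
  · field_simp
  · rw [sub_neg_eq_add, sub_neg_eq_add, ← sub_eq_add_neg q 1]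
    field_simp

/-- for an odd prime `ℓ`, `r` with `ℓ ∤ r`, `α ≥ 1` and `β = max(α,2)`,
the proportion of `g ∈ GL₂(ℤ/ℓ^βℤ)` with `tr(g)² - 4 det(g) ≢ 0 (mod ℓ²)` and
`tr(g)² - 4 det(g) ≡ r (mod ℓ^α)` is `ℓ(ℓ-1-(r|ℓ)) / ((ℓ-1)(ℓ-(r|ℓ))ℓ^α)`.
The congruence conditions are imposed on the canonical representative
`(glDisc (ℓ^β) g).val` of `tr(g)² - 4 det(g)`. -/
theorem stmt18 (ℓ : ℕ) (hℓ : ℓ.Prime) (hℓ2 : ℓ ≠ 2) (r : ℤ) (hr : ¬ (ℓ : ℤ) ∣ r)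
    (α : ℕ) (hα : 1 ≤ α) (β : ℕ) (hβ : β = max α 2) :
    (Nat.card {g : Matrix.GeneralLinearGroup (Fin 2) (ZMod (ℓ ^ β)) //
        ¬ (ℓ ^ 2 ∣ (glDisc (ℓ ^ β) g).val) ∧
          ((glDisc (ℓ ^ β) g).val : ℤ) ≡ r [ZMOD ((ℓ : ℤ) ^ α)]} : ℝ) /
      (Nat.card (Matrix.GeneralLinearGroup (Fin 2) (ZMod (ℓ ^ β))) : ℝ) =
    (ℓ : ℝ) * ((ℓ : ℝ) - 1 - (jacobiSym r ℓ : ℝ)) /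
      (((ℓ : ℝ) - 1) * ((ℓ : ℝ) - (jacobiSym r ℓ : ℝ)) * (ℓ : ℝ) ^ α) := by
  have : Fact ℓ.Prime := ⟨hℓ⟩
  have : NeZero (ℓ ^ β) := ⟨pow_ne_zero _ hℓ.ne_zero⟩
  have : NeZero (ℓ ^ α) := ⟨pow_ne_zero _ hℓ.ne_zero⟩
  have hαβ : α ≤ β := hβ ▸ le_max_left _ _
  have hβ0 : β ≠ 0 := by omega
  have hα0 : α ≠ 0 := by omega
  have hdvd : ℓ ∣ ℓ ^ β := dvd_pow_self _ hβ0
  have hdvdα : ℓ ^ α ∣ ℓ ^ β := pow_dvd_pow _ hαβ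
  have := ZMod.isLocalHom_castHom_prime_pow hℓ hdvd
  set f := ZMod.castHom hdvd (ZMod ℓ)
  set g := ZMod.castHom hdvdα (ZMod (ℓ ^ α))
  have hf : Function.Surjective f := ZMod.castHom_surjective hdvd
  have hg : Function.Surjective g := ZMod.castHom_surjective hdvdα
  have hr0 : (r : ZMod ℓ) ≠ 0 := by rwa [ne_eq, ZMod.intCast_zmod_eq_zero_iff_dvd]
  have h2 : (2 : ZMod ℓ) ≠ 0 := by
    intro h
    have h' : ((2 : ℕ) : ZMod ℓ) = 0 := by exact_mod_cast h
    rw [ZMod.natCast_eq_zero_iff] at h'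
    exact hℓ2 ((Nat.prime_dvd_prime_iff_eq hℓ Nat.prime_two).mp h')
  have hmod : ∀ n : ℤ, n ≡ r [ZMOD ((ℓ : ℤ) ^ α)] → n ≡ r [ZMOD ℓ] := fun n h =>
    h.of_dvd (dvd_pow_self _ hα0)
  have hgr : ∀ x : ZMod (ℓ ^ β), g x = r ↔ (x.val : ℤ) ≡ r [ZMOD ((ℓ : ℤ) ^ α)] := by
    intro x
    rw [ZMod.castHom_eq_intCast_iff, Nat.cast_pow]
  have hcond : ∀ x : ZMod (ℓ ^ β),
      (¬ (ℓ ^ 2 ∣ x.val) ∧ (x.val : ℤ) ≡ r [ZMOD ((ℓ : ℤ) ^ α)]) ↔ g x = r := by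
    intro x
    rw [hgr]
    refine and_iff_right_of_imp fun h hx => hr ?_
    have hx' : (ℓ : ℤ) ∣ x.val :=
      Int.natCast_dvd_natCast.mpr ((dvd_pow_self ℓ two_ne_zero).trans hx)
    exact (hmod _ h).dvd_iff.mp hx'
  have hnum := card_isUnit_det_and_disc f hf h2 hr0 (fun x => g x = r) (by
    intro x hx
    exact (ZMod.castHom_eq_intCast_iff _ _ _).mpr (hmod _ ((hgr x).mp hx)))
  have hsub := Matrix.card_GL_subtype (n := Fin 2) (S := ZMod (ℓ ^ β))
    fun A => g (A.trace ^ 2 - 4 * A.det) = r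
  have hsub' : Nat.card {a : Matrix.GeneralLinearGroup (Fin 2) (ZMod (ℓ ^ β)) //
        ¬ (ℓ ^ 2 ∣ (glDisc (ℓ ^ β) a).val) ∧
          ((glDisc (ℓ ^ β) a).val : ℤ) ≡ r [ZMOD ((ℓ : ℤ) ^ α)]} = _ :=
    (Nat.card_congr (Equiv.subtypeEquivRight fun a => hcond (glDisc (ℓ ^ β) a))).trans hsub
  have hden := card_GL_fin_two_mul f hf
  have hM := f.card_fiber_mul_card hf 0
  have hQ := g.toAddMonoidHom.card_filter_comp_mul_card hg (fun y => y = (r : ZMod (ℓ ^ α)))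
  change (Finset.card {x | g x = (r : ZMod (ℓ ^ α))}) * _ = _ at hQ
  rw [Matrix.card_GL_field, Fin.prod_univ_two] at hden
  rw [Finset.filter_eq'] at hQ
  simp only [Finset.mem_univ, if_true, Finset.card_singleton, one_mul, ZMod.card]
    at hQ hM hden hnum
  have hχ : quadraticChar (ZMod ℓ) (r : ZMod ℓ) = jacobiSym r ℓ := by
    rw [← jacobiSym.legendreSym.to_jacobiSym]
    rfl
  have hχ1 : jacobiSym r ℓ = 1 ∨ jacobiSym r ℓ = -1 :=
    hχ ▸ quadraticChar_dichotomy hr0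
  rw [hχ] at hnum
  rw [← hsub'] at hnum
  have hq : 1 < ℓ := hℓ.one_lt
  have hGcast : ((((ℓ ^ 2 - ℓ ^ ((0 : Fin 2) : ℕ)) * (ℓ ^ 2 - ℓ ^ ((1 : Fin 2) : ℕ)) : ℕ)) : ℝ) =
      ((ℓ : ℝ) ^ 2 - 1) * ((ℓ : ℝ) ^ 2 - ℓ) := by
    rw [Nat.cast_mul, Nat.cast_sub (Nat.pow_le_pow_right hq.le (by simp)),
      Nat.cast_sub (Nat.pow_le_pow_right hq.le (by simp))]
    simp
  have hden' := congrArg (Nat.cast (R := ℝ)) hden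
  rw [Nat.cast_mul, Nat.cast_mul, hGcast] at hden'
  have hnum' := congrArg (Int.cast (R := ℝ)) hnum
  have hM' := congrArg (Nat.cast (R := ℝ)) hM
  have hQ' := congrArg (Nat.cast (R := ℝ)) hQ
  have hq' : (1 : ℝ) < ℓ := by exact_mod_cast hq
  rw [Int.cast_natCast] at hnum'
  rw [hnum']
  push_cast at hden' hM' hQ' ⊢
  have hN : (0 : ℝ) < (ℓ : ℝ) ^ β := by positivity
  have ha : (0 : ℝ) < (ℓ : ℝ) ^ α := by positivity
  refine count_div_card_GL_eq hq' hN ha hM' hQ' hden' ?_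
  rcases hχ1 with h | h <;> simp [h]
end
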